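/- arXiv:1609.07339 — 2 statements merged into one kernel-verified Lean document; each statement's English description precedes it below -/
import Mathlib

section
/- Let (A,B) be a random vector such that A satisfies Assumption (A3) with parameters κ > 0, θ ∈ (0,1) and h > 0, and E[|B|^ν] < ∞ for some ν > κ. Let X be a random variable independent of (A,B) whose distribution satisfies the perpetuity equation X =_d AX + B. Then there exist functions q₁, q₂ ∈ 𝒬(κ,h) such that lim_{n→∞} p_n^{−1} x^κ e^{κnh} P(X > x e^{nh}) = q₁(x) for every continuity point x > 0 of q₁, and lim_{n→∞} p_n^{−1} x^κ e^{κnh} P(X < −x e^{nh}) = q₂(x) for every continuity point x > 0 of q₂, where p_n = F_κ(nh) − F_κ(nh−). Moreover, if P(Ax + B = x) < 1 for every x ∈ ℝ, then q₁(x) + q₂(x) > 0 for all x > 0. -/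
open MeasureTheory ProbabilityTheory Filter Topology

noncomputable section

/-- `q ∈ 𝒬(κ,h)`: `q : (0,∞) → [0,∞)`, `x ↦ x^{-κ} q(x)` is nonincreasing on `(0,∞)`,
and `q(x e^h) = q(x)` for all `x > 0`. -/
def MemQ (κ h : ℝ) (q : ℝ → ℝ) : Prop :=
  (∀ x : ℝ, 0 < x → 0 ≤ q x) ∧
  AntitoneOn (fun x : ℝ => x ^ (-κ) * q x) (Set.Ioi (0 : ℝ)) ∧
  (∀ x : ℝ, 0 < x → q (x * Real.exp h) = q x)

/-- The conditional distribution of `log A` given `A ≠ 0` is arithmetic with span `h`. -/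
def CondLogArithSpan {Ω : Type*} [MeasurableSpace Ω] (P : Measure Ω) (A : Ω → ℝ)
    (h : ℝ) : Prop :=
  0 < h ∧
  P {ω | A ω ≠ 0 ∧ ∀ k : ℤ, Real.log (A ω) ≠ (k : ℝ) * h} = 0 ∧
  ∀ h' : ℝ, 0 < h' →
    P {ω | A ω ≠ 0 ∧ ∀ k : ℤ, Real.log (A ω) ≠ (k : ℝ) * h'} = 0 → h' ≤ h

/-- The exponentially tilted distribution of `log A`: the measure `C ↦ E[1{log A ∈ C} A^κ]`
(the integrand vanishing on `{A = 0}` since `κ > 0`); it has total mass `E A^κ = θ`. -/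
def tiltedLog {Ω : Type*} [MeasurableSpace Ω] (P : Measure Ω) (A : Ω → ℝ)
    (κ : ℝ) : Measure ℝ :=
  Measure.map (fun ω => Real.log (A ω)) (P.withDensity fun ω => ENNReal.ofReal (A ω ^ κ))

/-- The normalized tilted distribution, with distribution function
`F_κ(x) = θ⁻¹ E[1{log A ≤ x} A^κ]`. -/
def normTilted {Ω : Type*} [MeasurableSpace Ω] (P : Measure Ω) (A : Ω → ℝ)
    (κ θ : ℝ) : Measure ℝ :=
  (ENNReal.ofReal θ)⁻¹ • tiltedLog P A κ

/-- Convolution of two measures on `ℝ`. -/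
def mconv (μ ν : Measure ℝ) : Measure ℝ :=
  Measure.map (fun p : ℝ × ℝ => p.1 + p.2) (μ.prod ν)

/-- The point masses `p_k = F_κ(kh) - F_κ(kh-)` of the normalized tilted distribution. -/
def pA3 {Ω : Type*} [MeasurableSpace Ω] (P : Measure Ω) (A : Ω → ℝ)
    (κ θ h : ℝ) (k : ℤ) : ℝ :=
  (normTilted P A κ θ (Set.Iic ((k : ℝ) * h))).toReal -
    (normTilted P A κ θ (Set.Iio ((k : ℝ) * h))).toReal

/-- The point masses `p_k^{*2} = (F_κ*F_κ)(kh) - (F_κ*F_κ)(kh-)`. -/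
def p2A3 {Ω : Type*} [MeasurableSpace Ω] (P : Measure Ω) (A : Ω → ℝ)
    (κ θ h : ℝ) (k : ℤ) : ℝ :=
  (mconv (normTilted P A κ θ) (normTilted P A κ θ) (Set.Iic ((k : ℝ) * h))).toReal -
    (mconv (normTilted P A κ θ) (normTilted P A κ θ) (Set.Iio ((k : ℝ) * h))).toReal

/-- Assumption (A3): `A ≥ 0` a.s., `E A^κ = θ ∈ (0,1)`, `log A | A ≠ 0` arithmetic with
span `h`, the normalized tilted distribution function `F_κ` is `h`-subexponential
(`p_{n+1}/p_n → 1` and `p_n^{*2}/p_n → 2`), and `sup_{k ≥ n} p_k = O(p_n)`. -/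
def AssumptionA3 {Ω : Type*} [MeasurableSpace Ω] (P : Measure Ω) (A : Ω → ℝ)
    (κ θ h : ℝ) : Prop :=
  0 < κ ∧ 0 < θ ∧ θ < 1 ∧ (∀ᵐ ω ∂P, 0 ≤ A ω) ∧ (∫ ω, A ω ^ κ ∂P) = θ ∧
  CondLogArithSpan P A h ∧
  Tendsto (fun n : ℕ => pA3 P A κ θ h (n + 1) / pA3 P A κ θ h n) atTop (𝓝 1) ∧
  Tendsto (fun n : ℕ => p2A3 P A κ θ h n / pA3 P A κ θ h n) atTop (𝓝 2) ∧
  ∃ C : ℝ, ∀ᶠ n : ℕ in atTop, ∀ k : ℕ, n ≤ k → pA3 P A κ θ h k ≤ C * pA3 P A κ θ h n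

/-- A probability sequence on `ℤ` that is subexponential at `+∞` in the local sense. -/
structure IsSubexpSeq (p : ℤ → ℝ) : Prop where
  nonneg : ∀ k, 0 ≤ p k
  hasSum : HasSum p 1
  ratio : Tendsto (fun n => p (n + 1) / p n) atTop (𝓝 1)
  conv : Tendsto (fun n => (∑' k, p k * p (n - k)) / p n) atTop (𝓝 2)
  bound : ∃ C : ℝ, ∀ᶠ n in atTop, ∀ k, n ≤ k → p k ≤ C * p n

namespace IsSubexpSeq

variable {p : ℤ → ℝ}

lemma le_one (hp : IsSubexpSeq p) (k : ℤ) : p k ≤ 1 :=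
  le_hasSum hp.hasSum k fun j _ => hp.nonneg j

lemma eventually_pos (hp : IsSubexpSeq p) : ∀ᶠ n in atTop, 0 < p n := by
  filter_upwards [hp.ratio.eventually (lt_mem_nhds (show (0 : ℝ) < 1 by norm_num))] with n hn
  refine (hp.nonneg n).lt_of_ne fun h0 => ?_
  rw [← h0, div_zero] at hn
  exact lt_irrefl _ hn

lemma tendsto_shift_nat (hp : IsSubexpSeq p) (m : ℕ) :
    Tendsto (fun n => p (n + m) / p n) atTop (𝓝 1) := by
  induction m with
  | zero =>
    refine tendsto_const_nhds.congr' ?_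
    filter_upwards [hp.eventually_pos] with n hn
    simp [hn.ne']
  | succ m ih =>
    have h1 := (hp.ratio.comp (tendsto_atTop_add_const_right atTop (m : ℤ) tendsto_id)).mul ih
    rw [one_mul] at h1
    refine h1.congr' ?_
    filter_upwards [(tendsto_atTop_add_const_right atTop (m : ℤ) tendsto_id).eventually
      hp.eventually_pos] with n hn
    simp only [id] at hn
    simp only [Function.comp, id]
    rw [div_mul_div_cancel₀ hn.ne']
    push_cast
    ring_nf

lemma tendsto_shift (hp : IsSubexpSeq p) (m : ℤ) :
    Tendsto (fun n => p (n - m) / p n) atTop (𝓝 1) := by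
  obtain ⟨k, rfl | rfl⟩ := m.eq_nat_or_neg
  · have h1 := ((hp.tendsto_shift_nat k).comp
      (tendsto_atTop_add_const_right atTop (-(k : ℤ)) tendsto_id)).inv₀ one_ne_zero
    rw [inv_one] at h1
    refine h1.congr fun n => ?_
    simp [sub_eq_add_neg]
  · simpa using hp.tendsto_shift_nat k

lemma summable_mul (hp : IsSubexpSeq p) {D : ℤ → ℝ} (hD : Summable D) (n : ℤ) :
    Summable fun m => D m * p (n - m) := by
  refine Summable.of_norm_bounded hD.norm fun m => ?_
  rw [norm_mul]
  refine mul_le_of_le_one_right (norm_nonneg _) ?_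
  rw [Real.norm_of_nonneg (hp.nonneg _)]
  exact hp.le_one _

lemma hasSum_reflect (hp : IsSubexpSeq p) (n : ℤ) : HasSum (fun m => p (n - m)) 1 :=
  (Equiv.subLeft n).hasSum_iff.mpr hp.hasSum

lemma summable_bdd_mul (hp : IsSubexpSeq p) {D : ℤ → ℝ} {M : ℝ} (hD : ∀ m, |D m| ≤ M) (n : ℤ) :
    Summable fun m => D m * p (n - m) := by
  refine Summable.of_norm_bounded ((hp.hasSum_reflect n).summable.mul_left M) fun m => ?_
  rw [norm_mul, Real.norm_of_nonneg (hp.nonneg _)]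
  exact mul_le_mul_of_nonneg_right (hD m) (hp.nonneg _)

lemma sum_add_tsum_indicator {f : ℤ → ℝ} (hf : Summable f) (S : Finset ℤ) :
    ∑ m ∈ S, f m + ∑' m, ((S : Set ℤ)ᶜ).indicator f m = ∑' m, f m := by
  rw [← tsum_subtype]
  exact hf.sum_add_tsum_compl

lemma tendsto_tsum_indicator (f : ℤ → ℝ) :
    Tendsto (fun S : Finset ℤ => ∑' m, ((S : Set ℤ)ᶜ).indicator f m) atTop (𝓝 0) := by
  simp_rw [← tsum_subtype]
  exact tendsto_tsum_compl_atTop_zero f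

lemma tendsto_window (hp : IsSubexpSeq p) (D : ℤ → ℝ) (S : Finset ℤ) :
    Tendsto (fun n => (∑ m ∈ S, D m * p (n - m)) / p n) atTop (𝓝 (∑ m ∈ S, D m)) := by
  simp_rw [Finset.sum_div, mul_div_assoc]
  refine tendsto_finsetSum _ fun m _ => ?_
  simpa using (hp.tendsto_shift m).const_mul (D m)

lemma conv_outside_window (hp : IsSubexpSeq p) {ε : ℝ} (hε : 0 < ε) :
    ∀ᶠ S : Finset ℤ in atTop, ∀ᶠ n in atTop,
      ∑' m, ((S : Set ℤ)ᶜ).indicator (fun m => p m * p (n - m)) m ≤ (1 + ε) * p n := by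
  have h1 : ∀ᶠ S : Finset ℤ in atTop, 1 - ε < ∑ m ∈ S, p m :=
    hp.hasSum.eventually (lt_mem_nhds (by linarith))
  filter_upwards [h1] with S hS
  have h2 := hp.conv.sub (hp.tendsto_window p S)
  filter_upwards [h2.eventually (gt_mem_nhds (show 2 - ∑ m ∈ S, p m < 1 + ε by linarith)),
    hp.eventually_pos] with n hn hpos
  have h3 := sum_add_tsum_indicator (hp.summable_mul hp.hasSum.summable n) S
  rw [← sub_div, div_lt_iff₀ hpos] at hn
  linarith

lemma tail_conv_le (hp : IsSubexpSeq p) {D : ℤ → ℝ} {M : ℝ} (hD0 : ∀ m, 0 ≤ D m)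
    (hDM : ∀ m, D m ≤ M) (hneg : Summable ((Set.Iio (0 : ℤ)).indicator D)) (N : ℤ)
    {ε : ℝ} (hε : 0 < ε) :
    ∀ᶠ S : Finset ℤ in atTop, ∀ᶠ n in atTop, ∀ δ K : ℝ, 0 ≤ δ → 0 ≤ K →
      (∀ m, N ≤ m → D m ≤ δ + K * p m) →
      ∑' m, ((S : Set ℤ)ᶜ).indicator (fun m => D m * p (n - m)) m ≤
        δ + (K * (1 + ε) + ε) * p n := by
  obtain ⟨C, hC⟩ := hp.bound
  have hsmall : ∀ᶠ S : Finset ℤ in atTop,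
      (∑' m, ((S : Set ℤ)ᶜ).indicator ((Set.Iio (0 : ℤ)).indicator D) m) * C < ε := by
    have := (tendsto_tsum_indicator ((Set.Iio (0 : ℤ)).indicator D)).mul_const C
    rw [zero_mul] at this
    exact this.eventually (gt_mem_nhds hε)
  filter_upwards [hsmall, hp.conv_outside_window hε,
    eventually_ge_atTop (Finset.Icc 0 N)] with S hS1 hS2 hS3
  filter_upwards [hS2, hC] with n hn1 hn2 δ K hδ hK hDle
  set e := ((S : Set ℤ)ᶜ).indicator ((Set.Iio (0 : ℤ)).indicator D) with he
  have hesum : Summable e := hneg.indicator _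
  have he0 : ∀ m, 0 ≤ e m := fun m =>
    Set.indicator_nonneg (fun _ _ => Set.indicator_nonneg (fun _ _ => hD0 _) _) _
  have hr := hp.hasSum_reflect n
  have hw : Summable (((S : Set ℤ)ᶜ).indicator (fun m => p m * p (n - m))) :=
    (hp.summable_mul hp.hasSum.summable n).indicator _
  have hpt : ∀ m, ((S : Set ℤ)ᶜ).indicator (fun m => D m * p (n - m)) m ≤
      δ * p (n - m) + K * ((S : Set ℤ)ᶜ).indicator (fun m => p m * p (n - m)) m
        + e m * (C * p n) := by
    intro m
    by_cases hm : m ∈ S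
    · have : e m = 0 := by simp [he, hm]
      simp only [Set.indicator, Set.mem_compl_iff, Finset.mem_coe, hm, not_true_eq_false,
        if_false, this]
      have := mul_nonneg hδ (hp.nonneg (n - m))
      linarith
    · simp only [Set.indicator, Set.mem_compl_iff, Finset.mem_coe, hm, not_false_eq_true,
        if_true]
      have hq := hp.nonneg (n - m)
      have hmN : m < 0 ∨ N ≤ m := by
        by_contra! hcon
        exact hm (hS3 (Finset.mem_Icc.mpr ⟨hcon.1, hcon.2.le⟩))
      rcases hmN with hmN | hmN
      · have h1 : e m = D m := by simp [he, hm, hmN]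
        have h2 : p (n - m) ≤ C * p n := hn2 _ (by linarith)
        have h3 := mul_le_mul_of_nonneg_left h2 (hD0 m)
        have h4 := mul_nonneg hδ hq
        have h5 := mul_nonneg hK (mul_nonneg (hp.nonneg m) hq)
        rw [h1]
        linarith
      · have h1 := mul_le_mul_of_nonneg_right (hDle m hmN) hq
        have h2 : 0 ≤ e m * (C * p n) :=
          mul_nonneg (he0 m) ((hp.nonneg n).trans (hn2 n le_rfl))
        linarith
  have hDsum : Summable (((S : Set ℤ)ᶜ).indicator (fun m => D m * p (n - m))) :=
    (hp.summable_bdd_mul (fun m => by rw [abs_of_nonneg (hD0 m)]; exact hDM m) n).indicator _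
  have hle := hDsum.tsum_le_tsum hpt
    (((hr.summable.mul_left δ).add (hw.mul_left K)).add (hesum.mul_right (C * p n)))
  rw [Summable.tsum_add ((hr.summable.mul_left δ).add (hw.mul_left K))
    (hesum.mul_right (C * p n)), Summable.tsum_add (hr.summable.mul_left δ) (hw.mul_left K),
    tsum_mul_left, tsum_mul_left, tsum_mul_right, hr.tsum_eq] at hle
  have h1 := mul_le_mul_of_nonneg_left hn1 hK
  have h2 := mul_le_mul_of_nonneg_right hS1.le (hp.nonneg n)
  linarith

/-- A bounded solution of the defective renewal equation is eventually dominated by `p`. -/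
lemma renewal_dominated (hp : IsSubexpSeq p) {G ψ : ℤ → ℝ} {M θ : ℝ} (hθ0 : 0 < θ) (hθ1 : θ < 1)
    (hG0 : ∀ m, 0 ≤ G m) (hGM : ∀ m, G m ≤ M)
    (hneg : Summable ((Set.Iio (0 : ℤ)).indicator G))
    (heq : ∀ n, G n = θ * ∑' m, G m * p (n - m) + ψ n)
    (hψ : Tendsto (fun n => ψ n / p n) atTop (𝓝 0)) :
    ∃ (N : ℤ) (K : ℝ), 0 ≤ K ∧ ∀ n, N ≤ n → G n ≤ K * p n := by
  obtain ⟨N, hN⟩ := eventually_atTop.mp hp.eventually_pos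
  have hM : 0 ≤ M := (hG0 0).trans (hGM 0)
  have hε : 0 < (1 - θ) / 2 := by linarith
  set ε := (1 - θ) / 2 with hεdef
  obtain ⟨S, hS⟩ := (hp.tail_conv_le hG0 hGM hneg N hε).exists
  have hwin := (hp.tendsto_window G S).eventually (gt_mem_nhds (lt_add_one _))
  obtain ⟨N₃, hN₃⟩ := eventually_atTop.mp (hS.and (hwin.and
    ((hψ.eventually (gt_mem_nhds (zero_lt_one' ℝ))).and hp.eventually_pos)))
  obtain ⟨K₁, hK₁⟩ := ((Set.finite_Icc N N₃).image fun n => M / p n).bddAbove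
  set W := ∑ m ∈ S, G m + 1 with hW
  have hW0 : 0 ≤ W := add_nonneg (Finset.sum_nonneg fun m _ => hG0 m) zero_le_one
  have hγ : 0 < 1 - θ * (1 + ε) := by rw [hεdef]; nlinarith
  set K := max K₁ ((θ * W + θ * ε + 1) / (1 - θ * (1 + ε))) with hK
  have hK0 : 0 ≤ K := le_max_of_le_right (by positivity)
  have hK2 : θ * W + θ * ε + 1 ≤ K * (1 - θ * (1 + ε)) := by
    rw [← div_le_iff₀ hγ]
    exact le_max_right _ _
  have key : ∀ j : ℕ, ∀ n, N ≤ n → G n ≤ θ ^ j * M + K * p n := by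
    intro j
    induction j with
    | zero =>
      intro n _
      have := mul_nonneg hK0 (hp.nonneg n)
      have := hGM n
      linarith
    | succ j ih =>
      intro n hn
      rcases le_total n N₃ with hn3 | hn3
      · have h1 : M / p n ≤ K :=
          (hK₁ (Set.mem_image_of_mem _ ⟨hn, hn3⟩)).trans (le_max_left _ _)
        rw [div_le_iff₀ (hN n hn)] at h1
        have h2 : 0 ≤ θ ^ (j + 1) * M := by positivity
        exact (hGM n).trans (by linarith)
      · obtain ⟨h1, h2, h3, h4⟩ := hN₃ n hn3
        have h5 := h1 (θ ^ j * M) K (by positivity) hK0 ih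
        rw [div_lt_iff₀ h4] at h2 h3
        have h6 := sum_add_tsum_indicator (hp.summable_bdd_mul
          (fun m => by rw [abs_of_nonneg (hG0 m)]; exact hGM m) n) S
        rw [heq n, ← h6]
        have h7 : θ * (∑ m ∈ S, G m * p (n - m) +
            ∑' m, ((S : Set ℤ)ᶜ).indicator (fun m => G m * p (n - m)) m) ≤
            θ * (W * p n + (θ ^ j * M + (K * (1 + ε) + ε) * p n)) :=
          mul_le_mul_of_nonneg_left (by linarith) hθ0.le
        have h8 := mul_le_mul_of_nonneg_right hK2 h4.le
        rw [pow_succ]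
        nlinarith
  refine ⟨N, K, hK0, fun n hn => ?_⟩
  have hlim : Tendsto (fun j : ℕ => θ ^ j * M + K * p n) atTop (𝓝 (0 * M + K * p n)) :=
    ((tendsto_pow_atTop_nhds_zero_of_lt_one hθ0.le hθ1).mul_const M).add_const _
  simpa using ge_of_tendsto' hlim fun j => key j n hn

lemma conv_sub_le (hp : IsSubexpSeq p) {D : ℤ → ℝ} (hD : Summable D) {N : ℤ} {s : ℝ}
    (hs : 0 ≤ s) (hDs : ∀ m, N ≤ m → |D m| ≤ s * p m) {η : ℝ} (hη : 0 < η) :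
    ∀ᶠ n in atTop, |∑' m, D m * p (n - m) - (∑' m, D m) * p n| ≤ (s + η) * p n := by
  set ε := η / (s + 4) with hε
  have hε0 : 0 < ε := by positivity
  have hεη : ε * (s + 4) = η := by rw [hε]; field_simp
  have habs := hD.abs
  have hM : ∀ m, |D m| ≤ ∑' k, |D k| := fun m => habs.le_tsum m fun _ _ => abs_nonneg _
  have h1 := hp.tail_conv_le (fun m => abs_nonneg (D m)) hM (habs.indicator _) N hε0
  have h2 : ∀ᶠ S : Finset ℤ in atTop, |∑ m ∈ S, D m - ∑' m, D m| < ε := by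
    have := (Metric.tendsto_nhds.mp hD.hasSum) ε hε0
    simpa [Real.dist_eq] using this
  obtain ⟨S, hS1, hS2⟩ := (h1.and h2).exists
  have h3 := Metric.tendsto_nhds.mp (hp.tendsto_window D S) ε hε0
  filter_upwards [hS1, h3, hp.eventually_pos] with n hn1 hn2 hpos
  have h4 := hn1 0 s le_rfl hs (by simpa using hDs)
  have h5 := sum_add_tsum_indicator (hp.summable_mul hD n) S
  have h6 : |∑' m, ((S : Set ℤ)ᶜ).indicator (fun m => D m * p (n - m)) m| ≤
      ∑' m, ((S : Set ℤ)ᶜ).indicator (fun m => |D m| * p (n - m)) m := by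
    have hsum : Summable (((S : Set ℤ)ᶜ).indicator (fun m => |D m| * p (n - m))) :=
      (hp.summable_mul habs n).indicator _
    have hcongr : (fun m => ‖((S : Set ℤ)ᶜ).indicator (fun m => D m * p (n - m)) m‖) =
        ((S : Set ℤ)ᶜ).indicator (fun m => |D m| * p (n - m)) := by
      funext m
      rw [norm_indicator_eq_indicator_norm]
      congr 1
      funext k
      rw [norm_mul, Real.norm_of_nonneg (hp.nonneg _), Real.norm_eq_abs]
    have := norm_tsum_le_tsum_norm (hcongr ▸ hsum)
    rwa [hcongr] at this
  rw [Real.dist_eq] at hn2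
  have h7 : |∑ m ∈ S, D m * p (n - m) - (∑ m ∈ S, D m) * p n| ≤ ε * p n := by
    have : (∑ m ∈ S, D m * p (n - m)) / p n - ∑ m ∈ S, D m =
        (∑ m ∈ S, D m * p (n - m) - (∑ m ∈ S, D m) * p n) / p n := by
      field_simp
    rw [this, abs_div, abs_of_pos hpos, div_lt_iff₀ hpos] at hn2
    exact hn2.le
  have h8 : |(∑ m ∈ S, D m) * p n - (∑' m, D m) * p n| ≤ ε * p n := by
    rw [← sub_mul, abs_mul, abs_of_pos hpos]
    exact mul_le_mul_of_nonneg_right hS2.le hpos.le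
  rw [← h5, abs_le]
  rw [abs_le] at h6 h7 h8
  have h9 : (s + η) * p n = (s * (1 + ε) + ε) * p n + 3 * (ε * p n) := by
    rw [← hεη]; ring
  constructor <;> linarith [h6.1, h6.2, h7.1, h7.2, h8.1, h8.2]

/-- The key renewal theorem for the defective renewal equation with locally subexponential
step distribution. -/
theorem renewal_tendsto (hp : IsSubexpSeq p) {G ψ : ℤ → ℝ} {M θ : ℝ} (hθ0 : 0 < θ) (hθ1 : θ < 1)
    (hG0 : ∀ m, 0 ≤ G m) (hGM : ∀ m, G m ≤ M)
    (hneg : Summable ((Set.Iio (0 : ℤ)).indicator G))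
    (heq : ∀ n, G n = θ * ∑' m, G m * p (n - m) + ψ n)
    (hψ : Tendsto (fun n => ψ n / p n) atTop (𝓝 0)) :
    Summable G ∧ Tendsto (fun n => G n / p n) atTop (𝓝 (θ / (1 - θ) * ∑' m, G m)) := by
  obtain ⟨N, K, hK0, hK⟩ := hp.renewal_dominated hθ0 hθ1 hG0 hGM hneg heq hψ
  have hM : 0 ≤ M := (hG0 0).trans (hGM 0)
  have hGsum : Summable G := by
    have hfin : Summable ((Set.Icc 0 N).indicator fun _ : ℤ => M) :=
      summable_of_hasFiniteSupport ((Set.finite_Icc 0 N).subset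
        (Function.support_subset_iff'.mpr fun m hm => Set.indicator_of_notMem hm _))
    refine Summable.of_norm_bounded ((hneg.add hfin).add (hp.hasSum.summable.mul_left K))
      fun m => ?_
    rw [Real.norm_of_nonneg (hG0 m)]
    have h1 : 0 ≤ (Set.Iio (0 : ℤ)).indicator G m := Set.indicator_nonneg (fun _ _ => hG0 _) _
    have h2 : 0 ≤ (Set.Icc 0 N).indicator (fun _ : ℤ => M) m :=
      Set.indicator_nonneg (fun _ _ => hM) _
    have h3 := mul_nonneg hK0 (hp.nonneg m)
    rcases lt_or_ge m 0 with hm | hm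
    · have : (Set.Iio (0 : ℤ)).indicator G m = G m := Set.indicator_of_mem (Set.mem_Iio.mpr hm) _
      linarith
    · rcases le_total N m with hmN | hmN
      · linarith [hK m hmN]
      · have : (Set.Icc 0 N).indicator (fun _ : ℤ => M) m = M :=
          Set.indicator_of_mem (Set.mem_Icc.mpr ⟨hm, hmN⟩) _
        linarith [hGM m]
  refine ⟨hGsum, ?_⟩
  set g := θ / (1 - θ) * ∑' m, G m with hg
  have h1θ : 0 < 1 - θ := by linarith
  have hg0 : 0 ≤ g := mul_nonneg (by positivity) (tsum_nonneg hG0)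
  have hgeq : θ * (∑' m, G m) = (1 - θ) * g := by rw [hg]; field_simp
  set D : ℤ → ℝ := fun n => G n - g * p n with hDdef
  have hDsum : Summable D := hGsum.sub (hp.hasSum.summable.mul_left g)
  have hDtsum : ∑' m, D m = ∑' m, G m - g := by
    rw [hDdef, hGsum.tsum_sub (hp.hasSum.summable.mul_left g), tsum_mul_left,
      hp.hasSum.tsum_eq, mul_one]
  set T : Set ℝ := {s | 0 ≤ s ∧ ∀ᶠ n in atTop, |D n| ≤ s * p n} with hT
  have hstep : ∀ s ∈ T, ∀ η : ℝ, 0 < η → θ * s + η ∈ T := by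
    rintro s ⟨hs0, hs⟩ η hη
    refine ⟨by positivity, ?_⟩
    obtain ⟨N', hN'⟩ := eventually_atTop.mp hs
    have hη' : 0 < η / (3 * (1 + g)) := by positivity
    set η' := η / (3 * (1 + g)) with hη'def
    have hη'eq : η' * (3 * (1 + g)) = η := by rw [hη'def]; field_simp
    filter_upwards [hp.conv_sub_le hDsum hs0 hN' hη', Metric.tendsto_nhds.mp hp.conv η' hη',
      Metric.tendsto_nhds.mp hψ η' hη', hp.eventually_pos] with n h1 h2 h3 hpos
    rw [Real.dist_eq, sub_zero, abs_div, abs_of_pos hpos, div_lt_iff₀ hpos] at h3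
    have h2' : |∑' m, p m * p (n - m) - 2 * p n| < η' * p n := by
      have : (∑' m, p m * p (n - m)) / p n - 2 = (∑' m, p m * p (n - m) - 2 * p n) / p n := by
        field_simp
      rwa [Real.dist_eq, this, abs_div, abs_of_pos hpos, div_lt_iff₀ hpos] at h2
    have hconv : ∑' m, D m * p (n - m) =
        ∑' m, G m * p (n - m) - g * ∑' m, p m * p (n - m) := by
      rw [← tsum_mul_left, ← (hp.summable_mul hGsum n).tsum_sub
        ((hp.summable_mul hp.hasSum.summable n).mul_left g)]
      refine tsum_congr fun m => ?_
      simp only [hDdef]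
      ring
    have hDn : D n = θ * (∑' m, D m * p (n - m) - (∑' m, D m) * p n) +
        θ * g * (∑' m, p m * p (n - m) - 2 * p n) + ψ n := by
      rw [hconv, hDtsum]
      simp only [hDdef]
      rw [heq n]
      linear_combination p n * hgeq
    rw [hDn]
    have a1 : |θ * (∑' m, D m * p (n - m) - (∑' m, D m) * p n)| ≤ θ * ((s + η') * p n) := by
      rw [abs_mul, abs_of_pos hθ0]
      exact mul_le_mul_of_nonneg_left h1 hθ0.le
    have a2 : |θ * g * (∑' m, p m * p (n - m) - 2 * p n)| ≤ θ * g * (η' * p n) := by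
      rw [abs_mul, abs_of_nonneg (by positivity : 0 ≤ θ * g)]
      exact mul_le_mul_of_nonneg_left h2'.le (by positivity)
    have a3 : θ * (η' * p n) ≤ η' * p n := mul_le_of_le_one_left (by positivity) hθ1.le
    have a4 : θ * (g * (η' * p n)) ≤ g * (η' * p n) :=
      mul_le_of_le_one_left (by positivity) hθ1.le
    have a5 : η * p n = 3 * (η' * p n) + 3 * (g * (η' * p n)) := by rw [← hη'eq]; ring
    have a6 : 0 ≤ g * (η' * p n) := by positivity
    have a7 : 0 ≤ η' * p n := by positivity
    refine (abs_add_three _ _ _).trans ?_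
    linarith
  have hTne : T.Nonempty := by
    refine ⟨K + g, by positivity, ?_⟩
    filter_upwards [eventually_ge_atTop N] with n hn
    have h1 := hK n hn
    have h2 := mul_nonneg hg0 (hp.nonneg n)
    have h3 := mul_nonneg hK0 (hp.nonneg n)
    simp only [hDdef]
    rw [abs_le]
    constructor <;> linarith [hG0 n]
  have hTbdd : BddBelow T := ⟨0, fun s hs => hs.1⟩
  have hinf : sInf T ≤ 0 := by
    by_contra! hpos
    have hγ : 0 < (1 - θ) * sInf T / 3 := by positivity
    obtain ⟨s, hsT, hs⟩ := exists_lt_of_csInf_lt hTne (lt_add_of_pos_right (sInf T) hγ)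
    have h1 := csInf_le hTbdd (hstep s hsT _ hγ)
    nlinarith
  rw [Metric.tendsto_nhds]
  intro ε hε
  obtain ⟨s, hsT, hs⟩ := exists_lt_of_csInf_lt hTne (hinf.trans_lt hε)
  filter_upwards [hsT.2, hp.eventually_pos] with n hn hpos
  have : G n / p n - g = D n / p n := by simp only [hDdef]; field_simp
  rw [Real.dist_eq, this, abs_div, abs_of_pos hpos, div_lt_iff₀ hpos]
  exact hn.trans_lt (mul_lt_mul_of_pos_right hs hpos)

end IsSubexpSeq

section Lattice

variable {Ω : Type*} [MeasurableSpace Ω] {P : Measure Ω} {A : Ω → ℝ} {κ θ h : ℝ}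

lemma Int.cast_mul_injective (hh : 0 < h) : Function.Injective fun k : ℤ => (k : ℝ) * h :=
  fun i j hij => by exact_mod_cast mul_right_cancel₀ hh.ne' hij

lemma ae_eq_zero_or_exp (hA0 : ∀ᵐ ω ∂P, 0 ≤ A ω) (hspan : CondLogArithSpan P A h) :
    ∀ᵐ ω ∂P, A ω = 0 ∨ ∃ k : ℤ, A ω = Real.exp (k * h) := by
  have h2 : ∀ᵐ ω ∂P, ¬(A ω ≠ 0 ∧ ∀ k : ℤ, Real.log (A ω) ≠ (k : ℝ) * h) := by
    rw [ae_iff]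
    simpa only [not_not] using hspan.2.1
  filter_upwards [hA0, h2] with ω h0 hω
  by_cases hz : A ω = 0
  · exact Or.inl hz
  · push Not at hω
    obtain ⟨k, hk⟩ := hω hz
    exact Or.inr ⟨k, by rw [← hk, Real.exp_log (h0.lt_of_ne' hz)]⟩

lemma lintegral_ofReal_rpow (hA0 : ∀ᵐ ω ∂P, 0 ≤ A ω) (hθ0 : 0 < θ)
    (hθ : ∫ ω, A ω ^ κ ∂P = θ) :
    ∫⁻ ω, ENNReal.ofReal (A ω ^ κ) ∂P = ENNReal.ofReal θ := by
  have hint : Integrable (fun ω => A ω ^ κ) P := by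
    by_contra hcon
    rw [integral_undef hcon] at hθ
    exact hθ0.ne hθ
  rw [← ofReal_integral_eq_lintegral_ofReal hint
    (hA0.mono fun ω hω => Real.rpow_nonneg hω κ), hθ]

lemma measurable_ofReal_rpow (hA : Measurable A) :
    Measurable fun ω => ENNReal.ofReal (A ω ^ κ) :=
  (hA.pow_const κ).ennreal_ofReal

lemma isProbabilityMeasure_normTilted (hA : Measurable A) (hA0 : ∀ᵐ ω ∂P, 0 ≤ A ω)
    (hθ0 : 0 < θ) (hθ : ∫ ω, A ω ^ κ ∂P = θ) :
    IsProbabilityMeasure (normTilted P A κ θ) := by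
  refine ⟨?_⟩
  rw [normTilted, tiltedLog, Measure.smul_apply,
    Measure.map_apply hA.log MeasurableSet.univ, Set.preimage_univ,
    withDensity_apply _ MeasurableSet.univ, setLIntegral_univ,
    lintegral_ofReal_rpow hA0 hθ0 hθ, smul_eq_mul]
  exact ENNReal.inv_mul_cancel (by simpa using hθ0) ENNReal.ofReal_ne_top

lemma ae_normTilted_mem_lattice (hA : Measurable A) (hA0 : ∀ᵐ ω ∂P, 0 ≤ A ω) (hκ : 0 < κ)
    (hspan : CondLogArithSpan P A h) :
    ∀ᵐ x ∂(normTilted P A κ θ), x ∈ ⋃ k : ℤ, {(k : ℝ) * h} := by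
  refine Measure.ae_smul_measure ?_ _
  have hmeas : MeasurableSet {x : ℝ | x ∈ ⋃ k : ℤ, {(k : ℝ) * h}} :=
    MeasurableSet.iUnion fun k => measurableSet_singleton _
  rw [tiltedLog, ae_map_iff hA.log.aemeasurable hmeas,
    ae_withDensity_iff (measurable_ofReal_rpow hA)]
  filter_upwards [ae_eq_zero_or_exp hA0 hspan] with ω hω hne
  rcases hω with hω | ⟨k, hk⟩
  · rw [hω, Real.zero_rpow hκ.ne', ENNReal.ofReal_zero] at hne
    exact absurd rfl hne
  · exact Set.mem_iUnion.mpr ⟨k, by simp [hk]⟩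

lemma lintegral_normTilted (hA : Measurable A) (hA0 : ∀ᵐ ω ∂P, 0 ≤ A ω) (hκ : 0 < κ)
    (hspan : CondLogArithSpan P A h) (f : ℝ → ENNReal) :
    ∫⁻ x, f x ∂(normTilted P A κ θ) =
      ∑' k : ℤ, f (k * h) * normTilted P A κ θ {(k : ℝ) * h} := by
  have h1 := ae_normTilted_mem_lattice (θ := θ) hA hA0 hκ hspan
  rw [← Measure.restrict_eq_self_of_ae_mem h1,
    lintegral_iUnion (fun k : ℤ => measurableSet_singleton ((k : ℝ) * h))
      (fun i j hij => Set.disjoint_singleton.mpr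
        ((Int.cast_mul_injective hspan.1).ne hij)) f]
  simp_rw [lintegral_singleton]
  rw [Measure.restrict_eq_self_of_ae_mem h1]

lemma pA3_eq_measureReal (hA : Measurable A) (hA0 : ∀ᵐ ω ∂P, 0 ≤ A ω)
    (hθ0 : 0 < θ) (hθ : ∫ ω, A ω ^ κ ∂P = θ) (k : ℤ) :
    pA3 P A κ θ h k = (normTilted P A κ θ {(k : ℝ) * h}).toReal := by
  have := isProbabilityMeasure_normTilted hA hA0 hθ0 hθ
  rw [pA3, ← Set.Iic_sdiff_Iio_same, ← measureReal_def, ← measureReal_def, ← measureReal_def,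
    measureReal_sdiff Set.Iio_subset_Iic_self measurableSet_Iio]

lemma hasSum_pA3 (hA : Measurable A) (hA0 : ∀ᵐ ω ∂P, 0 ≤ A ω) (hκ : 0 < κ)
    (hθ0 : 0 < θ) (hθ : ∫ ω, A ω ^ κ ∂P = θ) (hspan : CondLogArithSpan P A h) :
    HasSum (pA3 P A κ θ h) 1 := by
  have := isProbabilityMeasure_normTilted hA hA0 hθ0 hθ
  have h1 := lintegral_normTilted (θ := θ) hA hA0 hκ hspan fun _ => 1
  simp only [lintegral_const, measure_univ, one_mul] at h1
  have h2 := ENNReal.hasSum_toReal (h1 ▸ ENNReal.one_ne_top)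
  rw [← ENNReal.tsum_toReal_eq fun _ => measure_ne_top _ _, ← h1, ENNReal.toReal_one] at h2
  refine h2.congr_fun ?_
  exact fun k => pA3_eq_measureReal hA hA0 hθ0 hθ k

lemma p2A3_eq_tsum (hA : Measurable A) (hA0 : ∀ᵐ ω ∂P, 0 ≤ A ω) (hκ : 0 < κ)
    (hθ0 : 0 < θ) (hθ : ∫ ω, A ω ^ κ ∂P = θ) (hspan : CondLogArithSpan P A h) (n : ℤ) :
    p2A3 P A κ θ h n = ∑' k, pA3 P A κ θ h k * pA3 P A κ θ h (n - k) := by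
  have := isProbabilityMeasure_normTilted hA hA0 hθ0 hθ
  set μ := normTilted P A κ θ with hμ
  have hadd : Measurable fun p : ℝ × ℝ => p.1 + p.2 := measurable_fst.add measurable_snd
  have hprob : IsProbabilityMeasure (mconv μ μ) :=
    Measure.isProbabilityMeasure_map hadd.aemeasurable
  have hset : MeasurableSet ((fun p : ℝ × ℝ => p.1 + p.2) ⁻¹' {(n : ℝ) * h}) :=
    hadd (measurableSet_singleton _)
  rw [p2A3, ← hμ, ← measureReal_def, ← measureReal_def,
    ← measureReal_sdiff Set.Iio_subset_Iic_self measurableSet_Iio, Set.Iic_sdiff_Iio_same,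
    measureReal_def, mconv, Measure.map_apply hadd (measurableSet_singleton _),
    Measure.prod_apply hset, hμ, lintegral_normTilted hA hA0 hκ hspan, ENNReal.tsum_toReal_eq]
  · refine tsum_congr fun k => ?_
    rw [ENNReal.toReal_mul, pA3_eq_measureReal hA hA0 hθ0 hθ,
      pA3_eq_measureReal hA hA0 hθ0 hθ, mul_comm]
    congr 3
    ext y
    simp only [Set.mem_preimage, Set.mem_singleton_iff]
    push_cast
    constructor <;> intro hy <;> linarith
  · exact fun k => ENNReal.mul_ne_top (measure_ne_top _ _) (measure_ne_top _ _)

lemma measureReal_eq_exp (hA : Measurable A) (hA0 : ∀ᵐ ω ∂P, 0 ≤ A ω) (hκ : 0 < κ)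
    (hθ0 : 0 < θ) (hθ : ∫ ω, A ω ^ κ ∂P = θ) (k : ℤ) :
    P.real {ω | A ω = Real.exp (k * h)} =
      θ * pA3 P A κ θ h k * Real.exp (-(κ * (k * h))) := by
  have hmeas : MeasurableSet ((fun ω => Real.log (A ω)) ⁻¹' {(k : ℝ) * h}) :=
    hA.log (measurableSet_singleton _)
  have hmeas' : MeasurableSet {ω | A ω = Real.exp (k * h)} :=
    hA (measurableSet_singleton _)
  rw [pA3_eq_measureReal hA hA0 hθ0 hθ, normTilted, tiltedLog, Measure.smul_apply,
    Measure.map_apply hA.log (measurableSet_singleton _),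
    withDensity_apply _ hmeas]
  have h1 : ∫⁻ ω in (fun ω => Real.log (A ω)) ⁻¹' {(k : ℝ) * h}, ENNReal.ofReal (A ω ^ κ) ∂P =
      ENNReal.ofReal (Real.exp (κ * (k * h))) * P {ω | A ω = Real.exp (k * h)} := by
    rw [← setLIntegral_const, ← lintegral_indicator hmeas, ← lintegral_indicator hmeas']
    refine lintegral_congr_ae ?_
    filter_upwards [hA0] with ω hω
    rcases hω.eq_or_lt with hz | hpos
    · have h2 : ω ∉ {ω | A ω = Real.exp (k * h)} := by
        simp only [Set.mem_ofPred_eq, ← hz]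
        exact (Real.exp_pos _).ne
      rw [Set.indicator_of_notMem h2]
      simp [Set.indicator, ← hz, Real.zero_rpow hκ.ne']
    · by_cases hk : Real.log (A ω) = k * h
      · have h2 : A ω = Real.exp (k * h) := by rw [← hk, Real.exp_log hpos]
        rw [Set.indicator_of_mem (by exact hk), Set.indicator_of_mem (by exact h2), h2,
          ← Real.exp_mul, mul_comm κ]
      · have h2 : A ω ≠ Real.exp (k * h) := fun hcon => hk (by rw [hcon, Real.log_exp])
        rw [Set.indicator_of_notMem (by exact hk), Set.indicator_of_notMem (by exact h2)]
  rw [h1, smul_eq_mul, ENNReal.toReal_mul, ENNReal.toReal_mul, ENNReal.toReal_inv,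
    ENNReal.toReal_ofReal hθ0.le, ENNReal.toReal_ofReal (Real.exp_pos _).le, measureReal_def,
    Real.exp_neg]
  have := Real.exp_pos (κ * (k * h))
  field_simp

lemma AssumptionA3.isSubexpSeq (hA : Measurable A) (hA3 : AssumptionA3 P A κ θ h) :
    IsSubexpSeq (pA3 P A κ θ h) := by
  obtain ⟨hκ, hθ0, -, hA0, hθ, hspan, hratio, hconv, C, hC⟩ := hA3
  refine ⟨fun k => ?_, hasSum_pA3 hA hA0 hκ hθ0 hθ hspan, ?_, ?_, C, ?_⟩
  · rw [pA3_eq_measureReal hA hA0 hθ0 hθ]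
    exact ENNReal.toReal_nonneg
  · rw [← Nat.map_cast_int_atTop]
    exact tendsto_map'_iff.mpr hratio
  · simp_rw [← p2A3_eq_tsum hA hA0 hκ hθ0 hθ hspan]
    rw [← Nat.map_cast_int_atTop]
    exact tendsto_map'_iff.mpr hconv
  · rw [← Nat.map_cast_int_atTop, eventually_map]
    filter_upwards [hC] with n hn k hk
    obtain ⟨m, rfl⟩ := Int.eq_ofNat_of_zero_le ((Int.natCast_nonneg n).trans hk)
    exact hn m (by exact_mod_cast hk)

end Lattice

section Functional

variable {Ω : Type*} [MeasurableSpace Ω] {P : Measure Ω} [IsProbabilityMeasure P]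
  {A X : Ω → ℝ} {h : ℝ}

lemma integrable_unit_comp {f : ℝ → ℝ} (hf : Measurable f) (hf0 : ∀ x, 0 ≤ f x)
    (hf1 : ∀ x, f x ≤ 1) {Y : Ω → ℝ} (hY : Measurable Y) : Integrable (fun ω => f (Y ω)) P :=
  Integrable.of_bound (hf.comp hY).aestronglyMeasurable 1
    (ae_of_all _ fun ω => by rw [Real.norm_of_nonneg (hf0 _)]; exact hf1 _)

lemma hasSum_integral_comp_mul (hA : Measurable A) (hX : Measurable X) (hAX : IndepFun A X P)
    (hh : 0 < h) (hlat : ∀ᵐ ω ∂P, A ω = 0 ∨ ∃ k : ℤ, A ω = Real.exp (k * h))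
    {f : ℝ → ℝ} (hf : Measurable f) (hf0 : ∀ x, 0 ≤ f x) (hf1 : ∀ x, f x ≤ 1) (hfz : f 0 = 0) :
    HasSum (fun k : ℤ => P.real {ω | A ω = Real.exp (k * h)} *
      ∫ ω, f (Real.exp (k * h) * X ω) ∂P) (∫ ω, f (A ω * X ω) ∂P) := by
  have hs : ∀ k : ℤ, MeasurableSet {ω | A ω = Real.exp (k * h)} := fun k =>
    hA (measurableSet_singleton _)
  have hdisj : Pairwise (Function.onFun Disjoint fun k : ℤ => {ω | A ω = Real.exp (k * h)}) := by
    intro i j hij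
    refine Set.disjoint_left.mpr fun ω hi hj => hij (Int.cast_mul_injective hh ?_)
    exact Real.exp_injective (hi.symm.trans hj)
  have hint := integrable_unit_comp (P := P) hf hf0 hf1 (hA.mul hX)
  have h1 := hasSum_integral_iUnion hs hdisj hint.integrableOn
  have h2 : ∫ ω in ⋃ k : ℤ, {ω | A ω = Real.exp (k * h)}, f ((A * X) ω) ∂P =
      ∫ ω, f (A ω * X ω) ∂P := by
    refine setIntegral_eq_integral_of_ae_compl_eq_zero ?_
    filter_upwards [hlat] with ω hω hnot
    rcases hω with hω | ⟨k, hk⟩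
    · simp [hω, hfz]
    · exact absurd (Set.mem_iUnion.mpr ⟨k, hk⟩) hnot
  rw [h2] at h1
  refine h1.congr_fun fun k => ?_
  have h3 : ∫ ω in {ω | A ω = Real.exp (k * h)}, f ((A * X) ω) ∂P =
      ∫ ω, ({Real.exp (k * h)} : Set ℝ).indicator 1 (A ω) *
        f (Real.exp (k * h) * X ω) ∂P := by
    rw [← integral_indicator (hs k)]
    refine integral_congr_ae (ae_of_all _ fun ω => ?_)
    by_cases hω : A ω = Real.exp (k * h) <;> simp [Set.indicator, hω]
  have hone : Measurable (({Real.exp (k * h)} : Set ℝ).indicator (1 : ℝ → ℝ)) :=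
    measurable_one.indicator (measurableSet_singleton _)
  have hfk : Measurable fun x : ℝ => f (Real.exp (k * h) * x) :=
    hf.comp (measurable_const.mul measurable_id)
  have h4 := (hAX.comp hone hfk).integral_fun_mul_eq_mul_integral
    (hone.comp hA).aestronglyMeasurable (hfk.comp hX).aestronglyMeasurable
  simp only [Function.comp_def] at h4
  rw [h3, h4]
  congr 1
  have h5 : (fun ω => ({Real.exp (k * h)} : Set ℝ).indicator (1 : ℝ → ℝ) (A ω)) =
      {ω | A ω = Real.exp (k * h)}.indicator 1 := by
    funext ω
    simp [Set.indicator]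
  rw [h5, integral_indicator_one (hs k)]

end Functional

section Tails

variable {Ω : Type*} [MeasurableSpace Ω] {P : Measure Ω}
  {A B X : Ω → ℝ} {κ θ h : ℝ} {p : ℤ → ℝ}

lemma measurableSet_lt_abs {Y : Ω → ℝ} (hY : Measurable Y) (t : ℝ) :
    MeasurableSet {ω | t < |Y ω|} :=
  measurableSet_lt measurable_const hY.abs

lemma integral_indicator_lt_abs {Y : Ω → ℝ} (hY : Measurable Y) (t : ℝ) :
    ∫ ω, ({x : ℝ | t < |x|} : Set ℝ).indicator 1 (Y ω) ∂P = P.real {ω | t < |Y ω|} := by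
  have : (fun ω => ({x : ℝ | t < |x|} : Set ℝ).indicator (1 : ℝ → ℝ) (Y ω)) =
      {ω | t < |Y ω|}.indicator 1 := by
    funext ω
    simp [Set.indicator]
  rw [this, integral_indicator_one (measurableSet_lt_abs hY t)]

lemma exists_measureReal_lt_abs_le_rpow (hB : Measurable B) {ν : ℝ} (hν : 0 < ν)
    (hBν : (∫⁻ ω, ENNReal.ofReal (|B ω| ^ ν) ∂P) < ⊤) :
    ∃ C, 0 ≤ C ∧ ∀ s, 0 < s → P.real {ω | s < |B ω|} ≤ C * s ^ (-ν) := by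
  refine ⟨(∫⁻ ω, ENNReal.ofReal (|B ω| ^ ν) ∂P).toReal, ENNReal.toReal_nonneg, fun s hs => ?_⟩
  have hsν : 0 < s ^ ν := Real.rpow_pos_of_pos hs ν
  have h1 := mul_meas_ge_le_lintegral₀ (μ := P)
    ((hB.abs.pow_const ν).ennreal_ofReal).aemeasurable (ENNReal.ofReal (s ^ ν))
  have h2 : P {ω | s < |B ω|} ≤
      P {ω | ENNReal.ofReal (s ^ ν) ≤ ENNReal.ofReal (|B ω| ^ ν)} :=
    measure_mono fun ω hω => ENNReal.ofReal_le_ofReal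
      (Real.rpow_le_rpow hs.le (le_of_lt hω) hν.le)
  have h3 := ENNReal.toReal_mono hBν.ne ((mul_le_mul_right h2 _).trans h1)
  rw [ENNReal.toReal_mul, ENNReal.toReal_ofReal hsν.le] at h3
  rw [Real.rpow_neg hs.le, ← div_eq_mul_inv, le_div_iff₀ hsν, mul_comm]
  exact h3

lemma map_measureReal_eq {Y Z : Ω → ℝ} (hY : Measurable Y) (hZ : Measurable Z)
    (hYZ : Measure.map Y P = Measure.map Z P) {s : Set ℝ} (hs : MeasurableSet s) :
    P.real (Y ⁻¹' s) = P.real (Z ⁻¹' s) := by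
  rw [measureReal_def, measureReal_def, ← Measure.map_apply hY hs, hYZ, Measure.map_apply hZ hs]

variable [IsProbabilityMeasure P]

lemma hasSum_measureReal_lt_abs_mul (hA : Measurable A) (hX : Measurable X)
    (hAX : IndepFun A X P) (hh : 0 < h)
    (hlat : ∀ᵐ ω ∂P, A ω = 0 ∨ ∃ k : ℤ, A ω = Real.exp (k * h)) {t : ℝ} (ht : 0 ≤ t) :
    HasSum (fun k : ℤ => P.real {ω | A ω = Real.exp (k * h)} *
      P.real {ω | t < |Real.exp (k * h) * X ω|}) (P.real {ω | t < |A ω * X ω|}) := by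
  have hm : Measurable (({x : ℝ | t < |x|} : Set ℝ).indicator (1 : ℝ → ℝ)) :=
    measurable_one.indicator (measurableSet_lt measurable_const measurable_id.abs)
  have h1 := hasSum_integral_comp_mul hA hX hAX hh hlat hm
    (fun x => Set.indicator_nonneg (fun _ _ => zero_le_one) x)
    (fun x => Set.indicator_le_self' (fun _ _ => zero_le_one) x)
    (by simp [Set.indicator, ht])
  rw [integral_indicator_lt_abs (Y := fun ω => A ω * X ω) (hA.mul hX)] at h1
  refine h1.congr_fun fun k => ?_
  rw [integral_indicator_lt_abs (hX.const_mul _)]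

lemma exists_hasSum_measureReal_exp (hA : Measurable A) (hh : 0 < h)
    (hlat : ∀ᵐ ω ∂P, A ω = 0 ∨ ∃ k : ℤ, A ω = Real.exp (k * h)) :
    ∃ s ≤ 1, HasSum (fun k : ℤ => P.real {ω | A ω = Real.exp (k * h)}) s := by
  refine ⟨_, measureReal_le_one, ((hasSum_measureReal_lt_abs_mul hA
    (measurable_const (a := (1 : ℝ))) (indepFun_const_right A 1) hh hlat le_rfl).congr_fun
      fun k => ?_)⟩
  have : {ω : Ω | 0 < |Real.exp (k * h) * 1|} = Set.univ := by
    ext ω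
    simp [Real.exp_pos]
  rw [this, probReal_univ, mul_one]

lemma measureReal_lt_abs_mul_le (hA : Measurable A) (hX : Measurable X)
    (hAX : IndepFun A X P) (hh : 0 < h) (hp : HasSum p 1)
    (hlat : ∀ᵐ ω ∂P, A ω = 0 ∨ ∃ k : ℤ, A ω = Real.exp (k * h))
    (ha : ∀ k : ℤ, P.real {ω | A ω = Real.exp (k * h)} = θ * p k * Real.exp (-(κ * (k * h))))
    {δ C : ℝ} (hδ : 0 ≤ δ)
    (hbound : ∀ t, 0 < t → P.real {ω | t < |X ω|} ≤ δ + C * t ^ (-κ)) {t : ℝ} (ht : 0 < t) :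
    P.real {ω | t < |A ω * X ω|} ≤ δ + C * θ * t ^ (-κ) := by
  obtain ⟨s, hs, hsum⟩ := exists_hasSum_measureReal_exp hA hh hlat
  have h1 := hasSum_measureReal_lt_abs_mul hA hX hAX hh hlat ht.le
  have h2 := (hsum.mul_left δ).add (hp.mul_left (C * θ * t ^ (-κ)))
  refine (hasSum_le (fun k => ?_) h1 h2).trans ?_
  · have hset : {ω | t < |Real.exp (k * h) * X ω|} = {ω | t / Real.exp (k * h) < |X ω|} := by
      ext ω
      simp only [Set.mem_ofPred_eq, abs_mul, Real.abs_exp]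
      rw [div_lt_iff₀' (Real.exp_pos _)]
    have hpos : 0 < t / Real.exp (k * h) := by positivity
    have hrpow : (t / Real.exp (k * h)) ^ (-κ) = t ^ (-κ) * Real.exp (κ * (k * h)) := by
      rw [Real.div_rpow ht.le (Real.exp_pos _).le, ← Real.exp_mul, div_eq_mul_inv,
        ← Real.exp_neg]
      congr 2
      ring
    rw [hset]
    calc P.real {ω | A ω = Real.exp (k * h)} * P.real {ω | t / Real.exp (k * h) < |X ω|}
        ≤ P.real {ω | A ω = Real.exp (k * h)} *
          (δ + C * (t ^ (-κ) * Real.exp (κ * (k * h)))) := by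
          rw [← hrpow]
          exact mul_le_mul_of_nonneg_left (hbound _ hpos) measureReal_nonneg
      _ = δ * P.real {ω | A ω = Real.exp (k * h)} + C * θ * t ^ (-κ) * p k := by
          rw [mul_add, mul_comm _ δ]
          congr 1
          rw [ha, Real.exp_neg]
          have := Real.exp_pos (κ * (k * h))
          field_simp
  · have := mul_le_of_le_one_right hδ hs
    linarith

lemma exists_measureReal_lt_abs_le_add {Y : Ω → ℝ} (hY : Measurable Y) {κ : ℝ} (hκ : 0 < κ)
    {δ : ℝ} (hδ : 0 < δ) :
    ∃ C, 0 ≤ C ∧ ∀ t, 0 < t → P.real {ω | t < |Y ω|} ≤ δ + C * t ^ (-κ) := by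
  have hlim : Tendsto (fun n : ℕ => P {ω | (n : ℝ) < |Y ω|}) atTop (𝓝 0) := by
    have h1 := tendsto_measure_iInter_atTop (μ := P) (s := fun n : ℕ => {ω | (n : ℝ) < |Y ω|})
      (fun n => (measurableSet_lt_abs hY n).nullMeasurableSet)
      (fun m n hmn ω (hω : (n : ℝ) < |Y ω|) => lt_of_le_of_lt (Nat.cast_le.mpr hmn) hω)
      ⟨0, measure_ne_top _ _⟩
    have h2 : ⋂ n : ℕ, {ω | (n : ℝ) < |Y ω|} = ∅ := by
      refine Set.eq_empty_of_forall_notMem fun ω hω => ?_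
      obtain ⟨n, hn⟩ := exists_nat_ge |Y ω|
      exact absurd (Set.mem_iInter.mp hω n) (not_lt.mpr hn)
    rwa [h2, measure_empty] at h1
  have hlim' := (ENNReal.tendsto_toReal ENNReal.zero_ne_top).comp hlim
  rw [ENNReal.toReal_zero] at hlim'
  obtain ⟨n, hn⟩ := (hlim'.eventually (gt_mem_nhds hδ)).exists
  refine ⟨(n : ℝ) ^ κ, by positivity, fun t ht => ?_⟩
  have htκ : 0 < t ^ κ := Real.rpow_pos_of_pos ht κ
  rcases le_or_gt (n : ℝ) t with hnt | hnt
  · have h1 : P.real {ω | t < |Y ω|} ≤ P.real {ω | (n : ℝ) < |Y ω|} :=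
      measureReal_mono fun ω hω => lt_of_le_of_lt hnt hω
    have h2 : 0 ≤ (n : ℝ) ^ κ * t ^ (-κ) := by positivity
    have h3 : P.real {ω | (n : ℝ) < |Y ω|} < δ := hn
    linarith
  · have h1 : 1 ≤ (n : ℝ) ^ κ * t ^ (-κ) := by
      rw [Real.rpow_neg ht.le, ← div_eq_mul_inv, one_le_div htκ]
      exact Real.rpow_le_rpow ht.le hnt.le hκ.le
    have h2 : P.real {ω | t < |Y ω|} ≤ 1 := measureReal_le_one
    linarith

/-- The solution of the perpetuity equation has a weak moment of order `κ`. -/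
lemma exists_measureReal_lt_abs_perpetuity_le (hA : Measurable A) (hB : Measurable B)
    (hX : Measurable X) (hAX : IndepFun A X P) (hh : 0 < h) (hκ : 0 < κ) (hθ0 : 0 < θ)
    (hθ1 : θ < 1) (hp : HasSum p 1)
    (hlat : ∀ᵐ ω ∂P, A ω = 0 ∨ ∃ k : ℤ, A ω = Real.exp (k * h))
    (ha : ∀ k : ℤ, P.real {ω | A ω = Real.exp (k * h)} = θ * p k * Real.exp (-(κ * (k * h))))
    {ν : ℝ} (hν : κ < ν) (hBν : (∫⁻ ω, ENNReal.ofReal (|B ω| ^ ν) ∂P) < ⊤)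
    (heq : Measure.map X P = Measure.map (fun ω => A ω * X ω + B ω) P) :
    ∃ C, 0 ≤ C ∧ ∀ t, 0 < t → P.real {ω | t < |X ω|} ≤ C * t ^ (-κ) := by
  obtain ⟨C₁, hC₁, hBtail⟩ := exists_measureReal_lt_abs_le_rpow hB (hκ.trans hν) hBν
  have hBtail' : ∀ s, 0 < s → P.real {ω | s < |B ω|} ≤ (C₁ + 1) * s ^ (-κ) := by
    intro s hs
    have hsκ : 0 < s ^ (-κ) := Real.rpow_pos_of_pos hs _
    rcases le_total 1 s with h1 | h1
    · refine (hBtail s hs).trans ?_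
      have : s ^ (-ν) ≤ s ^ (-κ) := Real.rpow_le_rpow_of_exponent_le h1 (by linarith)
      nlinarith
    · have h2 : 1 ≤ s ^ (-κ) := Real.one_le_rpow_of_pos_of_le_one_of_nonpos hs h1 (by linarith)
      refine (measureReal_le_one).trans ?_
      nlinarith
  set r : ℝ := θ ^ (1 / (2 * κ)) with hr
  have hr0 : 0 < r := Real.rpow_pos_of_pos hθ0 _
  have hr1 : r < 1 := Real.rpow_lt_one hθ0.le hθ1 (by positivity)
  have hrκ : θ * r ^ (-κ) = θ ^ (1 / 2 : ℝ) := by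
    rw [hr, ← Real.rpow_mul hθ0.le]
    nth_rewrite 1 [← Real.rpow_one θ]
    rw [← Real.rpow_add hθ0]
    congr 1
    field_simp
    ring
  set ρ : ℝ := θ ^ (1 / 2 : ℝ) with hρ
  have hρ0 : 0 ≤ ρ := by positivity
  have hρ1 : ρ < 1 := Real.rpow_lt_one hθ0.le hθ1 (by norm_num)
  set b : ℝ := (C₁ + 1) * (1 - r) ^ (-κ) with hb
  have hr2 : 0 < 1 - r := by linarith
  have hb0 : 0 ≤ b := by positivity
  have hstep : ∀ δ C : ℝ, 0 ≤ δ →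
      (∀ t, 0 < t → P.real {ω | t < |X ω|} ≤ δ + C * t ^ (-κ)) →
      ∀ t, 0 < t → P.real {ω | t < |X ω|} ≤ δ + (ρ * C + b) * t ^ (-κ) := by
    intro δ C hδ hbound t ht
    have h1 : P.real {ω | t < |X ω|} = P.real {ω | t < |A ω * X ω + B ω|} :=
      map_measureReal_eq hX ((hA.mul hX).add hB) heq
        (measurableSet_lt measurable_const measurable_id.abs)
    have h2 : {ω | t < |A ω * X ω + B ω|} ⊆
        {ω | r * t < |A ω * X ω|} ∪ {ω | (1 - r) * t < |B ω|} := by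
      intro ω hω
      by_contra hcon
      simp only [Set.mem_union, Set.mem_ofPred_eq, not_or, not_lt] at hcon hω
      have := abs_add_le (A ω * X ω) (B ω)
      linarith [hcon.1, hcon.2]
    have h3 := (measureReal_mono (μ := P) h2).trans (measureReal_union_le _ _)
    have h4 := measureReal_lt_abs_mul_le hA hX hAX hh hp hlat ha hδ hbound (mul_pos hr0 ht)
    have h5 := hBtail' _ (mul_pos hr2 ht)
    rw [Real.mul_rpow hr0.le ht.le] at h4
    rw [Real.mul_rpow hr2.le ht.le] at h5
    have h6 : C * θ * (r ^ (-κ) * t ^ (-κ)) = ρ * C * t ^ (-κ) := by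
      rw [← hrκ]; ring
    have h7 : (C₁ + 1) * ((1 - r) ^ (-κ) * t ^ (-κ)) = b * t ^ (-κ) := by
      rw [hb]; ring
    linarith
  have hρ2 : 0 < 1 - ρ := by linarith
  refine ⟨b / (1 - ρ), by positivity, fun t ht => ?_⟩
  refine le_of_forall_pos_le_add fun δ hδ => ?_
  obtain ⟨C, -, hC⟩ := exists_measureReal_lt_abs_le_add (P := P) hX hκ hδ
  have hiter : ∀ n : ℕ, ∀ t, 0 < t →
      P.real {ω | t < |X ω|} ≤ δ + (ρ ^ n * (C - b / (1 - ρ)) + b / (1 - ρ)) * t ^ (-κ) := by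
    intro n
    induction n with
    | zero => simpa using hC
    | succ n ih =>
      intro t ht
      convert hstep δ _ hδ.le ih t ht using 3
      rw [pow_succ]
      field_simp
      ring
  have hlim : Tendsto
      (fun n : ℕ => δ + (ρ ^ n * (C - b / (1 - ρ)) + b / (1 - ρ)) * t ^ (-κ)) atTop
      (𝓝 (δ + (0 * (C - b / (1 - ρ)) + b / (1 - ρ)) * t ^ (-κ))) :=
    ((((tendsto_pow_atTop_nhds_zero_of_lt_one hρ0 hρ1).mul_const _).add_const _).mul_const
      _).const_add _
  have := ge_of_tendsto' hlim fun n => hiter n t ht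
  linarith

/-- Adding `B` changes a truncated Lipschitz functional of `A X` at scale `T` by a quantity
of smaller polynomial order than `T ^ (-κ)`. -/
lemma exists_perturbation_le (hA : Measurable A) (hB : Measurable B) (hX : Measurable X)
    (hκ : 0 < κ) {C₀ : ℝ} (hAXtail : ∀ t, 0 < t → P.real {ω | t < |A ω * X ω|} ≤ C₀ * t ^ (-κ))
    {ν : ℝ} (hν : κ < ν) (hBν : (∫⁻ ω, ENNReal.ofReal (|B ω| ^ ν) ∂P) < ⊤)
    {f : ℝ → ℝ} (hf : Measurable f) (hf0 : ∀ x, 0 ≤ f x) (hf1 : ∀ x, f x ≤ 1)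
    {a L : ℝ} (ha : 0 < a) (hL : 0 ≤ L) (hfa : ∀ x ≤ a, f x = 0)
    (hLip : ∀ x y, |f x - f y| ≤ L * |x - y|) :
    ∃ K c : ℝ, 0 < c ∧ ∀ᶠ T : ℝ in atTop,
      |T ^ κ * (∫ ω, f ((A ω * X ω + B ω) / T) ∂P - ∫ ω, f (A ω * X ω / T) ∂P)| ≤
        K * T ^ (-c) := by
  obtain ⟨C₁, hC₁, hBtail⟩ := exists_measureReal_lt_abs_le_rpow hB (hκ.trans hν) hBν
  have hν0 : 0 < ν := hκ.trans hν
  set η : ℝ := (ν - κ) / (2 * ν) with hη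
  have hη0 : 0 < η := div_pos (by linarith) (by linarith)
  have hην : ν * η = (ν - κ) / 2 := by rw [hη]; field_simp
  set c : ℝ := min η ((ν - κ) / 2) with hc
  refine ⟨C₁ + L * |C₀| * (a / 2) ^ (-κ), c, lt_min hη0 (by linarith), ?_⟩
  have hsmall : ∀ᶠ T : ℝ in atTop, T ^ (-η) < a / 2 :=
    (tendsto_rpow_neg_atTop hη0).eventually (gt_mem_nhds (by positivity))
  filter_upwards [hsmall, eventually_ge_atTop 1] with T hT hT1
  have hT0 : 0 < T := by linarith
  set E₁ : Set Ω := {ω | T ^ (1 - η) < |B ω|} with hE₁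
  set E₂ : Set Ω := {ω | a / 2 * T < |A ω * X ω|} with hE₂
  have hAX : Measurable fun ω => A ω * X ω := hA.mul hX
  have hAXB : Measurable fun ω => A ω * X ω + B ω := hAX.add hB
  have hE₁m : MeasurableSet E₁ := measurableSet_lt_abs hB _
  have hE₂m : MeasurableSet E₂ := measurableSet_lt_abs hAX _
  have hpt : ∀ ω, |f ((A ω * X ω + B ω) / T) - f (A ω * X ω / T)| ≤
      E₁.indicator 1 ω + L * T ^ (-η) * E₂.indicator 1 ω := by
    intro ω
    have hTη : 0 ≤ T ^ (-η) := by positivity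
    have hi₁ : 0 ≤ E₁.indicator (1 : Ω → ℝ) ω := Set.indicator_nonneg (fun _ _ => zero_le_one) _
    have hi₂ : 0 ≤ E₂.indicator (1 : Ω → ℝ) ω := Set.indicator_nonneg (fun _ _ => zero_le_one) _
    have hi₃ : 0 ≤ L * T ^ (-η) * E₂.indicator (1 : Ω → ℝ) ω := by positivity
    by_cases h1 : ω ∈ E₁
    · have : |f ((A ω * X ω + B ω) / T) - f (A ω * X ω / T)| ≤ 1 := by
        rw [abs_le]
        constructor <;> linarith [hf0 ((A ω * X ω + B ω) / T), hf1 ((A ω * X ω + B ω) / T),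
          hf0 (A ω * X ω / T), hf1 (A ω * X ω / T)]
      rw [Set.indicator_of_mem h1, Pi.one_apply]
      linarith
    · have hBT : |B ω| / T ≤ T ^ (-η) := by
        have : |B ω| ≤ T ^ (1 - η) := not_lt.mp h1
        rw [sub_eq_add_neg, Real.rpow_add hT0, Real.rpow_one] at this
        rwa [div_le_iff₀' hT0]
      by_cases h2 : ω ∈ E₂
      · rw [Set.indicator_of_mem h2, Pi.one_apply, mul_one]
        refine (hLip _ _).trans ?_
        have : (A ω * X ω + B ω) / T - A ω * X ω / T = B ω / T := by ring
        rw [this, abs_div, abs_of_pos hT0]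
        linarith [mul_le_mul_of_nonneg_left hBT hL]
      · have h3 : |A ω * X ω| / T ≤ a / 2 := by
          rw [div_le_iff₀ hT0]
          exact not_lt.mp h2
        have h4 : A ω * X ω / T ≤ |A ω * X ω| / T :=
          div_le_div_of_nonneg_right (le_abs_self _) hT0.le
        have h5 : B ω / T ≤ |B ω| / T := div_le_div_of_nonneg_right (le_abs_self _) hT0.le
        rw [hfa (A ω * X ω / T) (by linarith), hfa ((A ω * X ω + B ω) / T)
          (by rw [add_div]; linarith), sub_self, abs_zero]
        linarith
  have hi₁ : Integrable (E₁.indicator (1 : Ω → ℝ)) P := (integrable_const 1).indicator hE₁m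
  have hi₂ : Integrable (E₂.indicator (1 : Ω → ℝ)) P := (integrable_const 1).indicator hE₂m
  have h1 : |∫ ω, f ((A ω * X ω + B ω) / T) ∂P - ∫ ω, f (A ω * X ω / T) ∂P| ≤
      P.real E₁ + L * T ^ (-η) * P.real E₂ := by
    rw [← integral_sub (integrable_unit_comp hf hf0 hf1 (hAXB.div_const T))
      (integrable_unit_comp hf hf0 hf1 (hAX.div_const T))]
    refine (abs_integral_le_integral_abs).trans ?_
    rw [← integral_indicator_one hE₁m, ← integral_indicator_one hE₂m, ← integral_const_mul,
      ← integral_add hi₁ (hi₂.const_mul _)]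
    exact integral_mono_of_nonneg (ae_of_all _ fun _ => abs_nonneg _)
      (hi₁.add (hi₂.const_mul _)) (ae_of_all _ hpt)
  have h2 := hBtail (T ^ (1 - η)) (by positivity)
  have h3 := hAXtail (a / 2 * T) (by positivity)
  rw [← Real.rpow_mul hT0.le] at h2
  rw [Real.mul_rpow (by positivity) hT0.le] at h3
  have hTκ : 0 < T ^ κ := by positivity
  have e1 : T ^ κ * T ^ ((1 - η) * -ν) ≤ T ^ (-c) := by
    rw [← Real.rpow_add hT0]
    refine Real.rpow_le_rpow_of_exponent_le hT1 ?_
    have : c ≤ (ν - κ) / 2 := min_le_right _ _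
    linarith
  have e2 : T ^ (-η) ≤ T ^ (-c) := by
    refine Real.rpow_le_rpow_of_exponent_le hT1 ?_
    have : c ≤ η := min_le_left _ _
    linarith
  have e3 : T ^ κ * T ^ (-κ) = 1 := by
    rw [← Real.rpow_add hT0, add_neg_cancel, Real.rpow_zero]
  rw [abs_mul, abs_of_pos hTκ]
  have hC₀ : C₀ * ((a / 2) ^ (-κ) * T ^ (-κ)) ≤ |C₀| * ((a / 2) ^ (-κ) * T ^ (-κ)) :=
    mul_le_mul_of_nonneg_right (le_abs_self _) (by positivity)
  calc T ^ κ * |∫ ω, f ((A ω * X ω + B ω) / T) ∂P - ∫ ω, f (A ω * X ω / T) ∂P|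
      ≤ T ^ κ * (C₁ * T ^ ((1 - η) * -ν) +
          L * T ^ (-η) * (|C₀| * ((a / 2) ^ (-κ) * T ^ (-κ)))) := by
        refine mul_le_mul_of_nonneg_left (h1.trans (add_le_add h2 ?_)) hTκ.le
        exact mul_le_mul_of_nonneg_left (h3.trans hC₀) (by positivity)
    _ = C₁ * (T ^ κ * T ^ ((1 - η) * -ν)) +
          L * |C₀| * (a / 2) ^ (-κ) * T ^ (-η) * (T ^ κ * T ^ (-κ)) := by ring
    _ ≤ C₁ * T ^ (-c) + L * |C₀| * (a / 2) ^ (-κ) * T ^ (-c) := by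
        rw [e3, mul_one]
        exact add_le_add (mul_le_mul_of_nonneg_left e1 hC₁)
          (mul_le_mul_of_nonneg_left e2 (by positivity))
    _ = (C₁ + L * |C₀| * (a / 2) ^ (-κ)) * T ^ (-c) := by ring

end Tails

section Ramp

/-- The piecewise linear function equal to `0` on `(-∞, a]` and to `1` on `[b, ∞)`. -/
def ramp (a b x : ℝ) : ℝ := max (min ((x - a) / (b - a)) 1) 0

variable {a b : ℝ}

lemma ramp_nonneg (x : ℝ) : 0 ≤ ramp a b x := le_max_right _ _

lemma ramp_le_one (x : ℝ) : ramp a b x ≤ 1 := max_le (min_le_right _ _) zero_le_one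

lemma ramp_eq_zero (hab : a < b) {x : ℝ} (hx : x ≤ a) : ramp a b x = 0 :=
  max_eq_right ((min_le_left _ _).trans
    (div_nonpos_of_nonpos_of_nonneg (by linarith) (by linarith)))

lemma ramp_eq_one (hab : a < b) {x : ℝ} (hx : b ≤ x) : ramp a b x = 1 := by
  have : 1 ≤ (x - a) / (b - a) := by rw [one_le_div (by linarith)]; linarith
  rw [ramp, min_eq_right this, max_eq_left zero_le_one]

lemma measurable_ramp : Measurable (ramp a b) :=
  (((measurable_id.sub_const a).div_const (b - a)).min measurable_const).max measurable_const

lemma abs_ramp_sub_le (hab : a < b) (x y : ℝ) :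
    |ramp a b x - ramp a b y| ≤ (b - a)⁻¹ * |x - y| := by
  refine (abs_max_sub_max_le_abs _ _ _).trans ?_
  refine (abs_min_sub_min_le_max _ _ _ _).trans ?_
  rw [sub_self, abs_zero, max_eq_left (abs_nonneg _), ← sub_div, abs_div,
    abs_of_pos (show 0 < b - a by linarith)]
  have : x - a - (y - a) = x - y := by ring
  rw [this, div_eq_inv_mul]

end Ramp

lemma IsSubexpSeq.tendsto_exp_neg_div {p : ℤ → ℝ} (hp : IsSubexpSeq p) {c : ℝ} (hc : 0 < c) :
    Tendsto (fun n : ℤ => Real.exp (-(c * n)) / p n) atTop (𝓝 0) := by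
  rw [← Nat.map_cast_int_atTop, tendsto_map'_iff]
  have hpos := hp.eventually_pos
  have hratio := hp.ratio
  rw [← Nat.map_cast_int_atTop] at hpos hratio
  rw [eventually_map] at hpos
  rw [tendsto_map'_iff] at hratio
  refine Summable.tendsto_atTop_zero (summable_of_ratio_test_tendsto_lt_one
    (l := Real.exp (-c)) (by simpa using hc) ?_ ?_)
  · filter_upwards [hpos] with n hn
    exact (div_pos (Real.exp_pos _) hn).ne'
  · have h1 := (hratio.inv₀ one_ne_zero).const_mul (Real.exp (-c))
    rw [inv_one, mul_one] at h1
    refine h1.congr' ?_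
    filter_upwards [hpos, (tendsto_add_atTop_nat 1).eventually hpos] with n hn hn1
    push_cast at hn1
    simp only [Function.comp]
    rw [Real.norm_of_nonneg (div_nonneg (Real.exp_pos _).le hn.le), Real.norm_of_nonneg]
    · push_cast
      have : Real.exp (-(c * ((n : ℝ) + 1))) = Real.exp (-c) * Real.exp (-(c * n)) := by
        rw [← Real.exp_add]; ring_nf
      rw [this]
      have := Real.exp_pos (-(c * n))
      field_simp
    · push_cast
      exact div_nonneg (Real.exp_pos _).le hn1.le

lemma summable_indicator_Iio_exp {c : ℝ} (hc : 0 < c) :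
    Summable ((Set.Iio (0 : ℤ)).indicator fun n : ℤ => Real.exp (c * n)) := by
  rw [summable_int_iff_summable_nat_and_neg]
  constructor
  · refine summable_zero.congr fun n => ?_
    simp
  · refine Summable.of_nonneg_of_le (fun n => Set.indicator_nonneg
      (fun _ _ => (Real.exp_pos _).le) _) (fun n => ?_)
      (Real.summable_exp_nat_mul_iff.mpr (neg_lt_zero.mpr hc))
    refine (Set.indicator_le_self' (fun _ _ => (Real.exp_pos _).le) _).trans (le_of_eq ?_)
    push_cast
    congr 1
    ring

/-- `X` is independent of `(A, B)` and solves the perpetuity equation `X =_d A X + B`, where `A`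
satisfies the arithmetic subexponential assumption and `B` has a moment of order above `κ`. -/
structure IsSubexpPerpetuity {Ω : Type*} [MeasurableSpace Ω] (P : Measure Ω) (A B X : Ω → ℝ)
    (κ θ h : ℝ) : Prop where
  measurable_A : Measurable A
  measurable_B : Measurable B
  measurable_X : Measurable X
  assumption : AssumptionA3 P A κ θ h
  moment : ∃ ν : ℝ, κ < ν ∧ (∫⁻ ω, ENNReal.ofReal (|B ω| ^ ν) ∂P) < ⊤
  indep : IndepFun (fun ω => (A ω, B ω)) X P
  map_eq : Measure.map X P = Measure.map (fun ω => A ω * X ω + B ω) P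

/-- The limit of the normalized right tail of `X`, without the factor `x ^ κ`. -/
def tailLimit {Ω : Type*} [MeasurableSpace Ω] (P : Measure Ω) (X : Ω → ℝ) (κ θ h x : ℝ) : ℝ :=
  θ / (1 - θ) * ∑' n : ℤ, Real.exp (κ * (n * h)) * P.real {ω | x * Real.exp (n * h) < X ω}

namespace IsSubexpPerpetuity

variable {Ω : Type*} [MeasurableSpace Ω] {P : Measure Ω} {A B X : Ω → ℝ} {κ θ h : ℝ}

lemma neg (H : IsSubexpPerpetuity P A B X κ θ h) :
    IsSubexpPerpetuity P A (fun ω => -B ω) (fun ω => -X ω) κ θ h where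
  measurable_A := H.measurable_A
  measurable_B := H.measurable_B.neg
  measurable_X := H.measurable_X.neg
  assumption := H.assumption
  moment := by simpa only [abs_neg] using H.moment
  indep := H.indep.comp (φ := fun p : ℝ × ℝ => (p.1, -p.2))
    (measurable_fst.prodMk measurable_snd.neg) measurable_neg
  map_eq := by
    have hAXB : Measurable fun ω => A ω * X ω + B ω :=
      (H.measurable_A.mul H.measurable_X).add H.measurable_B
    have h1 := congrArg (Measure.map fun x : ℝ => -x) H.map_eq
    rw [Measure.map_map measurable_neg H.measurable_X, Measure.map_map measurable_neg hAXB] at h1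
    have e : (fun ω => A ω * -X ω + -B ω) =
        (fun x : ℝ => -x) ∘ fun ω => A ω * X ω + B ω := by
      funext ω
      simp only [Function.comp]
      ring
    rw [e]
    exact h1

lemma ratio_pos (H : IsSubexpPerpetuity P A B X κ θ h) : 0 < θ / (1 - θ) :=
  div_pos H.assumption.2.1 (sub_pos.mpr H.assumption.2.2.1)

lemma tailLimit_mul_exp (x : ℝ) :
    tailLimit P X κ θ h (x * Real.exp h) = Real.exp (-(κ * h)) * tailLimit P X κ θ h x := by
  rw [tailLimit, tailLimit, mul_left_comm]
  congr 1
  rw [← (Equiv.addRight (1 : ℤ)).tsum_eq (fun n : ℤ => Real.exp (κ * (n * h)) *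
    P.real {ω | x * Real.exp (n * h) < X ω}), ← tsum_mul_left]
  refine tsum_congr fun n => ?_
  have e1 : x * Real.exp h * Real.exp (n * h) =
      x * Real.exp (((Equiv.addRight (1 : ℤ)) n : ℤ) * h) := by
    rw [mul_assoc, ← Real.exp_add, Equiv.coe_addRight]
    push_cast
    ring_nf
  have e2 : Real.exp (κ * (n * h)) =
      Real.exp (-(κ * h)) * Real.exp (κ * (((Equiv.addRight (1 : ℤ)) n : ℤ) * h)) := by
    rw [← Real.exp_add, Equiv.coe_addRight]
    push_cast
    ring_nf
  rw [e1, e2, mul_assoc]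

lemma tailLimit_nonneg (H : IsSubexpPerpetuity P A B X κ θ h) (x : ℝ) :
    0 ≤ tailLimit P X κ θ h x :=
  mul_nonneg H.ratio_pos.le (tsum_nonneg fun _ => by positivity)

variable [IsProbabilityMeasure P]

/-- Convergence of normalized expectations of truncated Lipschitz functionals. -/
lemma functional_tendsto (H : IsSubexpPerpetuity P A B X κ θ h) {f : ℝ → ℝ} (hf : Measurable f)
    (hf0 : ∀ x, 0 ≤ f x) (hf1 : ∀ x, f x ≤ 1) {a L : ℝ} (ha : 0 < a) (hL : 0 ≤ L)
    (hfa : ∀ x ≤ a, f x = 0) (hLip : ∀ x y, |f x - f y| ≤ L * |x - y|) :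
    Summable (fun n : ℤ => Real.exp (κ * (n * h)) * ∫ ω, f (X ω / Real.exp (n * h)) ∂P) ∧
    Tendsto (fun n : ℤ => (Real.exp (κ * (n * h)) * ∫ ω, f (X ω / Real.exp (n * h)) ∂P) /
      pA3 P A κ θ h n) atTop (𝓝 (θ / (1 - θ) *
        ∑' n : ℤ, Real.exp (κ * (n * h)) * ∫ ω, f (X ω / Real.exp (n * h)) ∂P)) := by
  have hp := H.assumption.isSubexpSeq H.measurable_A
  obtain ⟨hκ, hθ0, hθ1, hA0, hθ, hspan, -⟩ := H.assumption
  obtain ⟨ν, hν, hBν⟩ := H.moment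
  have hh := hspan.1
  have hA := H.measurable_A
  have hB := H.measurable_B
  have hX := H.measurable_X
  have hlat := ae_eq_zero_or_exp hA0 hspan
  have hmass := measureReal_eq_exp (h := h) hA hA0 hκ hθ0 hθ
  have hAX : IndepFun A X P := H.indep.comp measurable_fst measurable_id
  obtain ⟨C, hC0, hC⟩ := exists_measureReal_lt_abs_perpetuity_le hA hB hX hAX hh hκ hθ0 hθ1
    hp.hasSum hlat hmass hν hBν H.map_eq
  have hAXtail : ∀ t, 0 < t → P.real {ω | t < |A ω * X ω|} ≤ C * θ * t ^ (-κ) := by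
    intro t ht
    simpa using measureReal_lt_abs_mul_le hA hX hAX hh hp.hasSum hlat hmass le_rfl
      (by simpa using hC) ht
  obtain ⟨K, c, hc, hpert⟩ := exists_perturbation_le hA hB hX hκ hAXtail hν hBν hf hf0 hf1
    ha hL hfa hLip
  set p := pA3 P A κ θ h with hpdef
  have hint0 : ∀ n : ℤ, 0 ≤ ∫ ω, f (X ω / Real.exp (n * h)) ∂P := fun n =>
    integral_nonneg fun _ => hf0 _
  have hfX : ∀ n : ℤ, Integrable (fun ω => f (X ω / Real.exp (n * h))) P := fun n =>
    integrable_unit_comp hf hf0 hf1 (hX.div_const _)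
  refine hp.renewal_tendsto (M := C * a ^ (-κ)) (ψ := fun n : ℤ => Real.exp (κ * (n * h)) *
    (∫ ω, f ((A ω * X ω + B ω) / Real.exp (n * h)) ∂P -
      ∫ ω, f (A ω * X ω / Real.exp (n * h)) ∂P)) hθ0 hθ1 ?_ ?_ ?_ ?_ ?_
  · exact fun n => mul_nonneg (Real.exp_pos _).le (hint0 n)
  · intro n
    have hE := Real.exp_pos ((n : ℝ) * h)
    have h1 : ∫ ω, f (X ω / Real.exp (n * h)) ∂P ≤
        P.real {ω | a * Real.exp (n * h) < |X ω|} := by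
      have hm := measurableSet_lt_abs hX (a * Real.exp (n * h))
      rw [← integral_indicator_one hm]
      refine integral_mono (hfX n) ((integrable_const (1 : ℝ)).indicator hm) fun ω => ?_
      by_cases hω : a * Real.exp (n * h) < |X ω|
      · rw [Set.indicator_of_mem (show ω ∈ {ω | a * Real.exp (n * h) < |X ω|} from hω)]
        exact hf1 _
      · have : X ω / Real.exp (n * h) ≤ a := by
          rw [div_le_iff₀ hE]
          exact (le_abs_self _).trans (not_lt.mp hω)
        simp only [hfa _ this]
        exact Set.indicator_nonneg (fun _ _ => zero_le_one) _
    have h2 := hC (a * Real.exp (n * h)) (by positivity)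
    rw [Real.mul_rpow ha.le hE.le, ← Real.exp_mul] at h2
    have h3 : Real.exp (κ * (n * h)) * Real.exp (n * h * -κ) = 1 := by
      rw [← Real.exp_add, Real.exp_eq_one_iff]
      ring
    calc Real.exp (κ * (n * h)) * ∫ ω, f (X ω / Real.exp (n * h)) ∂P
        ≤ Real.exp (κ * (n * h)) * (C * (a ^ (-κ) * Real.exp (n * h * -κ))) :=
          mul_le_mul_of_nonneg_left (h1.trans h2) (Real.exp_pos _).le
      _ = C * a ^ (-κ) := by linear_combination (C * a ^ (-κ)) * h3
  · refine Summable.of_nonneg_of_le (fun n => Set.indicator_nonneg (fun k _ =>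
      mul_nonneg (Real.exp_pos _).le (hint0 k)) _) (fun n => ?_)
      (summable_indicator_Iio_exp (mul_pos hκ hh))
    refine Set.indicator_le_indicator ?_
    have h1 : ∫ ω, f (X ω / Real.exp (n * h)) ∂P ≤ 1 := by
      have := integral_mono (hfX n) (integrable_const (1 : ℝ)) fun ω => hf1 _
      simpa using this
    have h2 : κ * (n * h) = κ * h * n := by ring
    rw [h2]
    exact mul_le_of_le_one_right (Real.exp_pos _).le h1
  · intro n
    have hE := Real.exp_pos ((n : ℝ) * h)
    have hfn : Measurable fun x : ℝ => f (x / Real.exp (n * h)) :=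
      hf.comp (measurable_id.div_const _)
    have h1 : ∫ ω, f (X ω / Real.exp (n * h)) ∂P =
        ∫ ω, f ((A ω * X ω + B ω) / Real.exp (n * h)) ∂P := by
      have hAXB : Measurable fun ω => A ω * X ω + B ω := (hA.mul hX).add hB
      rw [← integral_map (f := fun x => f (x / Real.exp (n * h))) hX.aemeasurable
        hfn.aestronglyMeasurable, H.map_eq,
        integral_map hAXB.aemeasurable hfn.aestronglyMeasurable]
    have h2 := (hasSum_integral_comp_mul hA hX hAX hh hlat hfn (fun _ => hf0 _)
      (fun _ => hf1 _) (by simp [hfa 0 ha.le])).mul_left (Real.exp (κ * (n * h)))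
    have h3 : HasSum (fun k : ℤ => θ * ((Real.exp (κ * ((n - k : ℤ) * h)) *
        ∫ ω, f (X ω / Real.exp ((n - k : ℤ) * h)) ∂P) * p k))
        (Real.exp (κ * (n * h)) * ∫ ω, f (A ω * X ω / Real.exp (n * h)) ∂P) := by
      refine h2.congr_fun fun k => ?_
      have e1 : ∀ x : ℝ, Real.exp (k * h) * x / Real.exp (n * h) =
          x / Real.exp ((n - k : ℤ) * h) := by
        intro x
        push_cast
        rw [sub_mul, Real.exp_sub]
        have := Real.exp_pos ((k : ℝ) * h)
        field_simp
      have e2 : Real.exp (κ * ((n - k : ℤ) * h)) =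
          Real.exp (κ * (n * h)) * Real.exp (-(κ * (k * h))) := by
        rw [← Real.exp_add]
        push_cast
        ring_nf
      simp_rw [e1]
      rw [hmass, e2]
      ring
    have h4 := (Equiv.subLeft n).hasSum_iff.mpr h3
    simp only [Function.comp_def, Equiv.subLeft_apply, sub_sub_cancel] at h4
    rw [← tsum_mul_left, h4.tsum_eq, h1]
    ring
  · have hT : Tendsto (fun n : ℤ => Real.exp (n * h)) atTop atTop :=
      Real.tendsto_exp_atTop.comp (tendsto_intCast_atTop_atTop.atTop_mul_const hh)
    have hlim := (hp.tendsto_exp_neg_div (mul_pos hc hh)).const_mul K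
    rw [mul_zero] at hlim
    refine squeeze_zero_norm' ?_ hlim
    filter_upwards [hT.eventually hpert, hp.eventually_pos] with n hn hpos
    rw [← Real.exp_mul, ← Real.exp_mul] at hn
    rw [Real.norm_eq_abs, abs_div, abs_of_pos hpos, ← mul_div_assoc]
    refine div_le_div_of_nonneg_right ?_ hpos.le
    have e1 : (n : ℝ) * h * κ = κ * (n * h) := by ring
    have e2 : (n : ℝ) * h * -c = -(c * h * n) := by ring
    rwa [e1, e2] at hn

lemma measureReal_le_integral_ramp (hX : Measurable X) {a b : ℝ} (hab : a < b) {T : ℝ}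
    (hT : 0 < T) : P.real {ω | b * T < X ω} ≤ ∫ ω, ramp a b (X ω / T) ∂P := by
  have hm : MeasurableSet {ω | b * T < X ω} := measurableSet_lt measurable_const hX
  rw [← integral_indicator_one hm]
  refine integral_mono ((integrable_const (1 : ℝ)).indicator hm)
    (integrable_unit_comp measurable_ramp ramp_nonneg ramp_le_one (hX.div_const _)) fun ω => ?_
  refine Set.indicator_le' (g := fun ω => ramp a b (X ω / T)) (fun ω hω => ?_)
    (fun ω _ => ramp_nonneg _) ω
  rw [ramp_eq_one hab ((le_div_iff₀ hT).mpr (le_of_lt hω))]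
  exact le_rfl

lemma integral_ramp_le_measureReal (hX : Measurable X) {a b : ℝ} (hab : a < b) {T : ℝ}
    (hT : 0 < T) : ∫ ω, ramp a b (X ω / T) ∂P ≤ P.real {ω | a * T < X ω} := by
  have hm : MeasurableSet {ω | a * T < X ω} := measurableSet_lt measurable_const hX
  rw [← integral_indicator_one hm]
  refine integral_mono (integrable_unit_comp measurable_ramp ramp_nonneg ramp_le_one
    (hX.div_const _)) ((integrable_const (1 : ℝ)).indicator hm) fun ω => ?_
  refine Set.le_indicator (f := fun ω => ramp a b (X ω / T)) (fun ω _ => ramp_le_one _)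
    (fun ω hω => ?_) ω
  exact (ramp_eq_zero hab ((div_le_iff₀ hT).mpr (not_lt.mp hω))).le

lemma ramp_tendsto (H : IsSubexpPerpetuity P A B X κ θ h) {a b : ℝ} (ha : 0 < a) (hab : a < b) :
    Summable (fun n : ℤ => Real.exp (κ * (n * h)) *
      ∫ ω, ramp a b (X ω / Real.exp (n * h)) ∂P) ∧
    Tendsto (fun n : ℤ => (Real.exp (κ * (n * h)) *
      ∫ ω, ramp a b (X ω / Real.exp (n * h)) ∂P) / pA3 P A κ θ h n) atTop
      (𝓝 (θ / (1 - θ) * ∑' n : ℤ, Real.exp (κ * (n * h)) *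
        ∫ ω, ramp a b (X ω / Real.exp (n * h)) ∂P)) :=
  H.functional_tendsto measurable_ramp ramp_nonneg ramp_le_one ha
    (inv_nonneg.mpr (by linarith)) (fun _ hx => ramp_eq_zero hab hx) (abs_ramp_sub_le hab)

lemma summable_tail (H : IsSubexpPerpetuity P A B X κ θ h) {x : ℝ} (hx : 0 < x) :
    Summable fun n : ℤ => Real.exp (κ * (n * h)) * P.real {ω | x * Real.exp (n * h) < X ω} :=
  Summable.of_nonneg_of_le (fun _ => by positivity)
    (fun n => mul_le_mul_of_nonneg_left (measureReal_le_integral_ramp H.measurable_X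
      (half_lt_self hx) (Real.exp_pos _)) (Real.exp_pos _).le)
    (H.ramp_tendsto (half_pos hx) (half_lt_self hx)).1

lemma antitoneOn_tailLimit (H : IsSubexpPerpetuity P A B X κ θ h) :
    AntitoneOn (tailLimit P X κ θ h) (Set.Ioi 0) := by
  intro x hx y hy hxy
  refine mul_le_mul_of_nonneg_left (Summable.tsum_le_tsum (fun n => ?_) (H.summable_tail hy)
    (H.summable_tail hx)) H.ratio_pos.le
  refine mul_le_mul_of_nonneg_left (measureReal_mono fun ω hω => ?_) (Real.exp_pos _).le
  exact lt_of_le_of_lt (mul_le_mul_of_nonneg_right hxy (Real.exp_pos _).le) hω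

lemma tail_tendsto (H : IsSubexpPerpetuity P A B X κ θ h) {x : ℝ} (hx : 0 < x)
    (hcont : ContinuousAt (tailLimit P X κ θ h) x) :
    Tendsto (fun n : ℤ => (Real.exp (κ * (n * h)) *
      P.real {ω | x * Real.exp (n * h) < X ω}) / pA3 P A κ θ h n) atTop
      (𝓝 (tailLimit P X κ θ h x)) := by
  have hp := H.assumption.isSubexpSeq H.measurable_A
  rw [tendsto_order]
  constructor
  · intro c hc
    have h1 := (hcont.eventually (lt_mem_nhds hc)).filter_mono
      (nhdsWithin_le_nhds (s := Set.Ioi x))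
    obtain ⟨z, hz, hxz⟩ := (h1.and self_mem_nhdsWithin).exists
    have hxz : x < z := hxz
    obtain ⟨hsum, hlim⟩ := H.ramp_tendsto hx hxz
    have h2 : c < θ / (1 - θ) * ∑' n : ℤ, Real.exp (κ * (n * h)) *
        ∫ ω, ramp x z (X ω / Real.exp (n * h)) ∂P := by
      refine hz.trans_le (mul_le_mul_of_nonneg_left (Summable.tsum_le_tsum (fun n => ?_)
        (H.summable_tail (hx.trans hxz)) hsum) H.ratio_pos.le)
      exact mul_le_mul_of_nonneg_left (measureReal_le_integral_ramp H.measurable_X hxz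
        (Real.exp_pos _)) (Real.exp_pos _).le
    filter_upwards [hlim.eventually (lt_mem_nhds h2), hp.eventually_pos] with n hn hpos
    refine hn.trans_le (div_le_div_of_nonneg_right ?_ hpos.le)
    exact mul_le_mul_of_nonneg_left (integral_ramp_le_measureReal H.measurable_X hxz
      (Real.exp_pos _)) (Real.exp_pos _).le
  · intro c hc
    have h1 := (hcont.eventually (gt_mem_nhds hc)).filter_mono
      (nhdsWithin_le_nhds (s := Set.Iio x))
    obtain ⟨y, hy, hy0, hyx⟩ := (h1.and (Ioo_mem_nhdsLT hx)).exists
    obtain ⟨hsum, hlim⟩ := H.ramp_tendsto hy0 hyx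
    have h2 : θ / (1 - θ) * ∑' n : ℤ, Real.exp (κ * (n * h)) *
        ∫ ω, ramp y x (X ω / Real.exp (n * h)) ∂P < c := by
      refine (mul_le_mul_of_nonneg_left (Summable.tsum_le_tsum (fun n => ?_) hsum
        (H.summable_tail hy0)) H.ratio_pos.le).trans_lt hy
      exact mul_le_mul_of_nonneg_left (integral_ramp_le_measureReal H.measurable_X hyx
        (Real.exp_pos _)) (Real.exp_pos _).le
    filter_upwards [hlim.eventually (gt_mem_nhds h2), hp.eventually_pos] with n hn hpos
    refine (div_le_div_of_nonneg_right ?_ hpos.le).trans_lt hn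
    exact mul_le_mul_of_nonneg_left (measureReal_le_integral_ramp H.measurable_X hyx
      (Real.exp_pos _)) (Real.exp_pos _).le

lemma memQ (H : IsSubexpPerpetuity P A B X κ θ h) :
    MemQ κ h fun x => x ^ κ * tailLimit P X κ θ h x := by
  refine ⟨fun x hx => mul_nonneg (Real.rpow_nonneg hx.le _) (H.tailLimit_nonneg x), ?_, ?_⟩
  · refine H.antitoneOn_tailLimit.congr fun x (hx : 0 < x) => ?_
    simp only
    rw [← mul_assoc, ← Real.rpow_add hx, neg_add_cancel, Real.rpow_zero, one_mul]
  · intro x hx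
    simp only
    rw [tailLimit_mul_exp, Real.mul_rpow hx.le (Real.exp_pos _).le, ← Real.exp_mul,
      mul_comm h κ, Real.exp_neg]
    have := Real.exp_pos (κ * h)
    field_simp

lemma normalized_tail_tendsto (H : IsSubexpPerpetuity P A B X κ θ h) {x : ℝ} (hx : 0 < x)
    (hcont : ContinuousAt (fun x => x ^ κ * tailLimit P X κ θ h x) x) :
    Tendsto (fun n : ℕ => (pA3 P A κ θ h n)⁻¹ * x ^ κ * Real.exp (κ * (n * h)) *
      P.real {ω | x * Real.exp (n * h) < X ω}) atTop (𝓝 (x ^ κ * tailLimit P X κ θ h x)) := by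
  have hcont' : ContinuousAt (tailLimit P X κ θ h) x := by
    refine ((Real.continuousAt_rpow_const x (-κ) (Or.inl hx.ne')).mul hcont).congr ?_
    filter_upwards [lt_mem_nhds hx] with y hy
    show y ^ (-κ) * (y ^ κ * tailLimit P X κ θ h y) = _
    rw [← mul_assoc, ← Real.rpow_add hy, neg_add_cancel, Real.rpow_zero, one_mul]
  have h1 := ((H.tail_tendsto hx hcont').const_mul (x ^ κ)).comp tendsto_natCast_atTop_atTop
  refine h1.congr fun n => ?_
  simp only [Function.comp, Int.cast_natCast]
  ring

lemma tailLimit_pos (H : IsSubexpPerpetuity P A B X κ θ h) (hpos : P {ω | 0 < X ω} ≠ 0)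
    {x : ℝ} (hx : 0 < x) : 0 < tailLimit P X κ θ h x := by
  refine mul_pos H.ratio_pos ?_
  have hh : 0 < h := H.assumption.2.2.2.2.2.1.1
  have hex : ∃ n : ℕ, P {ω | x * Real.exp (((-n : ℤ) : ℝ) * h) < X ω} ≠ 0 := by
    by_contra! hcon
    refine hpos (measure_mono_null (fun ω (hω : 0 < X ω) => ?_) (measure_iUnion_null hcon))
    have hlim : Tendsto (fun n : ℕ => x * Real.exp (((-n : ℤ) : ℝ) * h)) atTop (𝓝 (x * 0)) := by
      refine (Real.tendsto_exp_atBot.comp ?_).const_mul x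
      push_cast
      exact (tendsto_neg_atTop_atBot.comp tendsto_natCast_atTop_atTop).atBot_mul_const hh
    rw [mul_zero] at hlim
    obtain ⟨n, hn⟩ := (hlim.eventually (gt_mem_nhds hω)).exists
    exact Set.mem_iUnion.mpr ⟨n, hn⟩
  obtain ⟨n, hn⟩ := hex
  exact (H.summable_tail hx).tsum_pos (fun _ => by positivity) (-n : ℤ)
    (mul_pos (Real.exp_pos _) (ENNReal.toReal_pos hn (measure_ne_top _ _)))

lemma measure_ne_zero (H : IsSubexpPerpetuity P A B X κ θ h)
    (hdeg : ∀ x : ℝ, P {ω | A ω * x + B ω = x} < 1) :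
    P {ω | 0 < X ω} ≠ 0 ∨ P {ω | 0 < -X ω} ≠ 0 := by
  by_contra! hcon
  have hX0 : ∀ᵐ ω ∂P, X ω = 0 := by
    refine measure_mono_null (fun ω (hω : X ω ≠ 0) => ?_) (measure_union_null hcon.1 hcon.2)
    rcases hω.lt_or_gt with h1 | h1
    · exact Or.inr (neg_pos.mpr h1)
    · exact Or.inl h1
  have hAXB : Measurable fun ω => A ω * X ω + B ω :=
    (H.measurable_A.mul H.measurable_X).add H.measurable_B
  have hAXB0 : ∀ᵐ ω ∂P, A ω * X ω + B ω = 0 := by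
    have h1 : ∀ᵐ y ∂(Measure.map X P), y = 0 :=
      (ae_map_iff H.measurable_X.aemeasurable (measurableSet_singleton (0 : ℝ))).mpr hX0
    rw [H.map_eq] at h1
    exact ae_of_ae_map hAXB.aemeasurable h1
  refine (hdeg 0).ne ((mem_ae_iff_prob_eq_one
    (measurableSet_eq_fun ((H.measurable_A.mul_const 0).add H.measurable_B)
      measurable_const)).mp ?_)
  filter_upwards [hX0, hAXB0] with ω h1 h2
  rwa [h1] at h2

end IsSubexpPerpetuity

/-- Theorem 9: perpetuity equation `X =_d AX + B` under (A3) and `E|B|^ν < ∞` for some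
`ν > κ`: two-sided tails with factor `p_n⁻¹`, positive in the nondegenerate case. -/
theorem stmt13 {Ω : Type*} [MeasurableSpace Ω] (P : Measure Ω) [IsProbabilityMeasure P]
    (A B X : Ω → ℝ) (hAmeas : Measurable A) (hBmeas : Measurable B) (hXmeas : Measurable X)
    (κ θ h : ℝ) (hA3 : AssumptionA3 P A κ θ h)
    (hB : ∃ ν : ℝ, κ < ν ∧ (∫⁻ ω, ENNReal.ofReal (|B ω| ^ ν) ∂P) < ⊤)
    (hindep : IndepFun (fun ω => (A ω, B ω)) X P)
    (heq : Measure.map X P = Measure.map (fun ω => A ω * X ω + B ω) P) :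
    ∃ q₁ q₂ : ℝ → ℝ, MemQ κ h q₁ ∧ MemQ κ h q₂ ∧
      (∀ x : ℝ, 0 < x → ContinuousAt q₁ x →
        Tendsto (fun n : ℕ =>
            (pA3 P A κ θ h n)⁻¹ * x ^ κ * Real.exp (κ * (n * h)) *
              (P {ω | X ω > x * Real.exp (n * h)}).toReal)
          atTop (𝓝 (q₁ x))) ∧
      (∀ x : ℝ, 0 < x → ContinuousAt q₂ x →
        Tendsto (fun n : ℕ =>
            (pA3 P A κ θ h n)⁻¹ * x ^ κ * Real.exp (κ * (n * h)) *
              (P {ω | X ω < -(x * Real.exp (n * h))}).toReal)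
          atTop (𝓝 (q₂ x))) ∧
      ((∀ x : ℝ, P {ω | A ω * x + B ω = x} < 1) →
        ∀ x : ℝ, 0 < x → 0 < q₁ x + q₂ x) := by
  have H : IsSubexpPerpetuity P A B X κ θ h :=
    ⟨hAmeas, hBmeas, hXmeas, hA3, hB, hindep, heq⟩
  refine ⟨fun x => x ^ κ * tailLimit P X κ θ h x,
    fun x => x ^ κ * tailLimit P (fun ω => -X ω) κ θ h x, H.memQ, H.neg.memQ, ?_, ?_, ?_⟩
  · exact fun x hx hcont => H.normalized_tail_tendsto hx hcont
  · intro x hx hcont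
    simpa only [lt_neg, Measure.real] using H.neg.normalized_tail_tendsto hx hcont
  · intro hdeg x hx
    have hxκ : 0 < x ^ κ := Real.rpow_pos_of_pos hx κ
    simp only
    rw [← mul_add]
    refine mul_pos hxκ ?_
    rcases H.measure_ne_zero hdeg with h1 | h1
    · exact add_pos_of_pos_of_nonneg (H.tailLimit_pos h1 hx) (H.neg.tailLimit_nonneg x)
    · exact add_pos_of_nonneg_of_pos (H.tailLimit_nonneg x) (H.neg.tailLimit_pos h1 hx)
end
end

section
/- Let A satisfy Assumption (A2) with parameters κ > 0, h > 0 and α ∈ (0,1], let U(x) = Σ_{n≥0} F_κ^{*n}(x) be the renewal function and u_n = U(nh) − U(nh−), and assume the strong renewal theorem holds: lim_{n→∞} u_n m(nh) = h C_α, where C_α = sin(απ)/((1−α)π) for α < 1 and C₁ = 1. Let z : ℝ → ℝ satisfy Σ_{j∈ℤ} |z(x + jh)| < ∞ for every x ∈ ℝ and sup_{y>0} y|z(y)| < ∞. Then for every x ∈ ℝ, lim_{n→∞} m(nh) ∫_ℝ z(x + nh − y) U(dy) = h C_α Σ_{j∈ℤ} z(x + jh). -/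
open MeasureTheory ProbabilityTheory Filter Topology

noncomputable section

/-- The distribution function `F_κ(x) = E[1{log A ≤ x} A^κ]`. -/
def Fk {Ω : Type*} [MeasurableSpace Ω] (P : Measure Ω) (A : Ω → ℝ) (κ : ℝ) (x : ℝ) : ℝ :=
  (tiltedLog P A κ (Set.Iic x)).toReal

/-- The truncated expectation `m(x) = ∫₀^x (1 - F_κ(y)) dy`. -/
def mFun {Ω : Type*} [MeasurableSpace Ω] (P : Measure Ω) (A : Ω → ℝ) (κ : ℝ) (x : ℝ) : ℝ :=
  ∫ y in Set.Ioc (0 : ℝ) x, (1 - Fk P A κ y)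

/-- `L` is slowly varying at infinity. -/
def SlowlyVarying (L : ℝ → ℝ) : Prop :=
  ∀ c : ℝ, 0 < c → Tendsto (fun x => L (c * x) / L x) atTop (𝓝 1)

/-- The Caravenna--Doney condition (eq:Doney-cond) for `F_κ`:
`lim_{δ→0} limsup_{x→∞} x (1-F_κ(x)) ∫_{(1,δx]} (y (1-F_κ(y))²)⁻¹ F_κ(dy) = 0`. -/
def DoneyCond {Ω : Type*} [MeasurableSpace Ω] (P : Measure Ω) (A : Ω → ℝ) (κ : ℝ) : Prop :=
  Tendsto (fun δ : ℝ =>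
      Filter.limsup (fun x : ℝ =>
        x * (1 - Fk P A κ x) *
          ∫ y in Set.Ioc (1 : ℝ) (δ * x), (y * (1 - Fk P A κ y) ^ 2)⁻¹ ∂(tiltedLog P A κ))
        atTop)
    (𝓝[>] (0 : ℝ)) (𝓝 0)

/-- Assumption (A2): `A ≥ 0` a.s., `E A^κ = 1`, `log A | A ≠ 0` arithmetic with span `h`,
`1 - F_κ(x) = ℓ(x) x^{-α}` with `ℓ` slowly varying and `α ∈ (0,1]` (infinite mean if
`α = 1`), and the condition (eq:Doney-cond) holds for `F_κ`. -/
def AssumptionA2 {Ω : Type*} [MeasurableSpace Ω] (P : Measure Ω) (A : Ω → ℝ)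
    (κ h α : ℝ) : Prop :=
  0 < κ ∧ (∀ᵐ ω ∂P, 0 ≤ A ω) ∧ (∫ ω, A ω ^ κ ∂P) = 1 ∧
  CondLogArithSpan P A h ∧
  0 < α ∧ α ≤ 1 ∧
  (∃ L : ℝ → ℝ, SlowlyVarying L ∧ ∀ x : ℝ, 0 < x → 1 - Fk P A κ x = L x * x ^ (-α)) ∧
  (α = 1 → (∫⁻ y, ENNReal.ofReal y ∂(tiltedLog P A κ)) = ⊤) ∧
  DoneyCond P A κ

/-- `n`-fold convolution power of a measure on `ℝ` (`μ^{*0} = δ₀`). -/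
def convPow (μ : Measure ℝ) : ℕ → Measure ℝ
  | 0 => Measure.dirac 0
  | n + 1 => mconv (convPow μ n) μ

/-- The renewal measure `U = Σ_{n≥0} μ^{*n}`. -/
def renewalMeasure (μ : Measure ℝ) : Measure ℝ :=
  Measure.sum fun n => convPow μ n

/-- A doubling bound with constant `ρ` gives a power bound with exponent `logb 2 ρ`. -/
lemma le_rpow_mul_of_doubling {M : ℕ → ℝ} (hM : Monotone M) (hM0 : ∀ n, 0 ≤ M n) {ρ : ℝ}
    (hρ : 1 ≤ ρ) {n₀ : ℕ} (hn₀ : 0 < n₀) (hd : ∀ n, n₀ ≤ n → M (2 * n) ≤ ρ * M n)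
    {k n : ℕ} (hk : n₀ ≤ k) (hkn : k ≤ n) :
    M n ≤ ρ * ((n : ℝ) / k) ^ Real.logb 2 ρ * M k := by
  have hk0 : 0 < k := hn₀.trans_le hk
  have hiter : ∀ i : ℕ, M (2 ^ i * k) ≤ ρ ^ i * M k := by
    intro i
    induction i with
    | zero => simp
    | succ i ih =>
      have h1 : n₀ ≤ 2 ^ i * k := hk.trans (Nat.le_mul_of_pos_left _ (by positivity))
      calc M (2 ^ (i + 1) * k) = M (2 * (2 ^ i * k)) := by congr 1; ring
        _ ≤ ρ * M (2 ^ i * k) := hd _ h1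
        _ ≤ ρ * (ρ ^ i * M k) := by gcongr
        _ = ρ ^ (i + 1) * M k := by ring
  set i := Nat.log 2 (n / k) with hi
  have hq : n / k ≠ 0 := (Nat.div_pos hkn hk0).ne'
  have hlo : 2 ^ i * k ≤ n :=
    (Nat.le_div_iff_mul_le hk0).1 (Nat.pow_log_le_self 2 hq)
  have hhi : n ≤ 2 ^ (i + 1) * k :=
    ((Nat.div_lt_iff_lt_mul hk0).1 (Nat.lt_pow_succ_log_self one_lt_two (n / k))).le
  have hpow : ρ ^ i ≤ ((n : ℝ) / k) ^ Real.logb 2 ρ := by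
    have h2 : ρ ^ i = ((2 : ℝ) ^ i) ^ Real.logb 2 ρ := by
      rw [← Real.rpow_natCast 2 i, ← Real.rpow_mul (by norm_num), mul_comm, Real.rpow_mul
        (by norm_num), Real.rpow_logb (by norm_num) (by norm_num) (by linarith),
        Real.rpow_natCast]
    rw [h2]
    apply Real.rpow_le_rpow (by positivity) _ (Real.logb_nonneg (by norm_num) hρ)
    rw [le_div_iff₀ (by exact_mod_cast hk0)]
    exact_mod_cast hlo
  calc M n ≤ M (2 ^ (i + 1) * k) := hM hhi
    _ ≤ ρ ^ (i + 1) * M k := hiter _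
    _ = ρ * ρ ^ i * M k := by ring
    _ ≤ _ := by have := hM0 k; gcongr

lemma sum_rpow_neg_le {β : ℝ} (hβ0 : 0 ≤ β) (hβ1 : β < 1) (N : ℕ) :
    ∑ k ∈ Finset.range N, ((k + 1 : ℕ) : ℝ) ^ (-β) ≤ (N : ℝ) ^ (1 - β) / (1 - β) := by
  induction N with
  | zero => simpa using div_nonneg (Real.rpow_nonneg le_rfl _) (by linarith : 0 ≤ 1 - β)
  | succ N ih =>
    rw [Finset.sum_range_succ]
    have hb : 0 < 1 - β := by linarith
    have hN : (0 : ℝ) < ((N + 1 : ℕ) : ℝ) := by positivity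
    have key : (N : ℝ) ^ (1 - β) ≤
        ((N + 1 : ℕ) : ℝ) ^ (1 - β) - (1 - β) * ((N + 1 : ℕ) : ℝ) ^ (-β) := by
      have hbern := rpow_one_add_le_one_add_mul_self (s := -1 / ((N + 1 : ℕ) : ℝ))
        (by rw [le_div_iff₀ hN]; push_cast; linarith [(Nat.cast_nonneg N : (0 : ℝ) ≤ N)])
        hb.le (by linarith)
      have e : (N : ℝ) = ((N + 1 : ℕ) : ℝ) * (1 + -1 / ((N + 1 : ℕ) : ℝ)) := by
        field_simp; push_cast; ring
      have e1 : 0 ≤ 1 + -1 / ((N + 1 : ℕ) : ℝ) := by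
        by_contra hneg
        have := mul_neg_of_pos_of_neg hN (not_le.1 hneg)
        rw [← e] at this
        exact absurd this (not_lt.2 (Nat.cast_nonneg N))
      have e2 : ((N + 1 : ℕ) : ℝ) ^ (-β) = ((N + 1 : ℕ) : ℝ) ^ (1 - β) / ((N + 1 : ℕ) : ℝ) := by
        rw [show -β = (1 - β) - 1 by ring, Real.rpow_sub_one hN.ne']
      calc (N : ℝ) ^ (1 - β)
          = ((N + 1 : ℕ) : ℝ) ^ (1 - β) * (1 + -1 / ((N + 1 : ℕ) : ℝ)) ^ (1 - β) := by
            rw [← Real.mul_rpow hN.le e1, ← e]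
        _ ≤ ((N + 1 : ℕ) : ℝ) ^ (1 - β) * (1 + (1 - β) * (-1 / ((N + 1 : ℕ) : ℝ))) := by gcongr
        _ = _ := by rw [e2]; ring
    rw [le_div_iff₀ hb] at ih ⊢
    nlinarith

/-- The part of the renewal sequence below `δ n` is negligible. -/
lemma exists_eventually_tsum_le {u : ℤ → ℝ} (hu0 : ∀ k, 0 ≤ u k)
    (hneg : ∀ N : ℕ, Summable fun k : ℤ => if k ≤ N then u k else 0)
    {M : ℕ → ℝ} (hM : Monotone M) (hM0 : ∀ n, 0 ≤ M n)
    {ρ : ℝ} (hρ : 1 ≤ ρ) (hρ2 : ρ < 2) {n₀ : ℕ} (hn₀ : 0 < n₀)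
    (hd : ∀ n, n₀ ≤ n → M (2 * n) ≤ ρ * M n) {B : ℝ} (hB : ∀ n : ℕ, u n * M n ≤ B)
    {ε : ℝ} (hε : 0 < ε) :
    ∃ δ : ℝ, 0 < δ ∧ δ ≤ 1 / 2 ∧ ∀ᶠ n : ℕ in atTop,
      M n / n * ∑' k : ℤ, (if (k : ℝ) < δ * n then u k else 0) ≤ ε := by
  set β := Real.logb 2 ρ with hβ
  have hβ0 : 0 ≤ β := Real.logb_nonneg (by norm_num) hρ
  have hβ1 : β < 1 := by
    rw [hβ, Real.logb_lt_iff_lt_rpow (by norm_num) (by linarith)]; simpa using hρ2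
  have hb : 0 < 1 - β := by linarith
  have hB0 : 0 ≤ B := (mul_nonneg (hu0 _) (hM0 0)).trans (hB 0)
  have hpow : ∀ k n : ℕ, n₀ ≤ k → k ≤ n → M n ≤ ρ * ((n : ℝ) / k) ^ β * M k :=
    fun k n h1 h2 => le_rpow_mul_of_doubling hM hM0 hρ hn₀ hd h1 h2
  set V := ∑' k : ℤ, if k ≤ n₀ then u k else 0 with hV
  obtain ⟨δ, hδ0, hδ2, hδ⟩ : ∃ δ : ℝ, 0 < δ ∧ δ ≤ 1 / 2 ∧
      ρ * B / (1 - β) * δ ^ (1 - β) < ε / 2 := by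
    have h1 : Tendsto (fun δ : ℝ => ρ * B / (1 - β) * δ ^ (1 - β)) (𝓝[>] 0) (𝓝 0) := by
      have : Tendsto (fun δ : ℝ => δ ^ (1 - β)) (𝓝[>] 0) (𝓝 0) := by
        have := (Real.continuousAt_rpow_const 0 (1 - β) (Or.inr hb.le)).tendsto
        rw [Real.zero_rpow hb.ne'] at this
        exact this.mono_left nhdsWithin_le_nhds
      simpa using this.const_mul (ρ * B / (1 - β))
    have h2 : ∀ᶠ δ : ℝ in 𝓝[>] 0, δ ≤ 1 / 2 :=
      nhdsWithin_le_nhds (Iic_mem_nhds (by norm_num))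
    obtain ⟨δ, ⟨h3, h4⟩, h5⟩ :=
      (((h1.eventually (gt_mem_nhds (half_pos hε))).and h2).and self_mem_nhdsWithin).exists
    exact ⟨δ, h5, h4, h3⟩
  refine ⟨δ, hδ0, hδ2, ?_⟩
  have hMn : Tendsto (fun n : ℕ => M n / n * V) atTop (𝓝 0) := by
    have h1 : Tendsto (fun n : ℕ => ρ * (1 / (n₀ : ℝ)) ^ β * M n₀ * (n : ℝ) ^ (-(1 - β)))
        atTop (𝓝 0) := by
      simpa using ((tendsto_rpow_neg_atTop hb).comp tendsto_natCast_atTop_atTop).const_mul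
        (ρ * (1 / (n₀ : ℝ)) ^ β * M n₀)
    have h2 : Tendsto (fun n : ℕ => M n / n) atTop (𝓝 0) := by
      refine tendsto_of_tendsto_of_tendsto_of_le_of_le' tendsto_const_nhds h1
        (Eventually.of_forall fun n => div_nonneg (hM0 n) n.cast_nonneg) ?_
      filter_upwards [eventually_ge_atTop n₀] with n hn
      have hn0 : (0 : ℝ) < n := by exact_mod_cast hn₀.trans_le hn
      rw [div_le_iff₀ hn0]
      refine (hpow n₀ n le_rfl hn).trans (le_of_eq ?_)
      rw [div_eq_mul_one_div, Real.mul_rpow hn0.le (by positivity), neg_sub,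
        Real.rpow_sub_one hn0.ne']
      field_simp
    simpa using h2.mul_const V
  filter_upwards [hMn.eventually (gt_mem_nhds (half_pos hε)), eventually_gt_atTop 0]
    with n hn hn0
  have hn0' : (0 : ℝ) < n := by exact_mod_cast hn0
  set N := ⌊δ * n⌋₊ with hN
  have hNle : (N : ℝ) ≤ δ * n := Nat.floor_le (by positivity)
  have hNn : N ≤ n := by
    have : (N : ℝ) ≤ n := by nlinarith
    exact_mod_cast this
  have hsplit : ∑' k : ℤ, (if (k : ℝ) < δ * n then u k else 0) ≤
      V + ∑ i ∈ Finset.range N with n₀ ≤ i + 1, u ((i + 1 : ℕ) : ℤ) := by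
    have hs2 : HasSum (fun k : ℤ => ∑ i ∈ Finset.range N with n₀ ≤ i + 1,
        if k = ((i + 1 : ℕ) : ℤ) then u ((i + 1 : ℕ) : ℤ) else 0)
        (∑ i ∈ Finset.range N with n₀ ≤ i + 1, u ((i + 1 : ℕ) : ℤ)) :=
      hasSum_sum fun i _ => hasSum_ite_eq _ _
    have hs := (hneg n₀).hasSum.add hs2
    have hle : ∀ k : ℤ, (if (k : ℝ) < δ * n then u k else 0) ≤
        (if k ≤ n₀ then u k else 0) + ∑ i ∈ Finset.range N with n₀ ≤ i + 1,
        if k = ((i + 1 : ℕ) : ℤ) then u ((i + 1 : ℕ) : ℤ) else 0 := by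
      intro k
      have hnn : ∀ i ∈ (Finset.range N).filter (fun i => n₀ ≤ i + 1),
          0 ≤ if k = ((i + 1 : ℕ) : ℤ) then u ((i + 1 : ℕ) : ℤ) else 0 := by
        intro i _; split_ifs
        · exact hu0 _
        · exact le_rfl
      by_cases hkn : k ≤ n₀
      · have := Finset.sum_nonneg hnn
        rw [if_pos hkn]
        split_ifs
        · linarith
        · linarith [hu0 k]
      · rw [if_neg hkn, zero_add]
        split_ifs with hkδ
        · push Not at hkn
          obtain ⟨i, rfl⟩ : ∃ i : ℕ, k = ((i + 1 : ℕ) : ℤ) := ⟨(k - 1).toNat, by omega⟩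
          have hi : i + 1 ≤ N := Nat.le_floor (by exact_mod_cast hkδ.le)
          refine le_trans (by simp) (Finset.single_le_sum hnn (a := i) ?_)
          simp only [Finset.mem_filter, Finset.mem_range]
          omega
        · exact Finset.sum_nonneg hnn
    rw [← hs.tsum_eq]
    exact (Summable.of_nonneg_of_le (fun k => by split_ifs <;> simp [hu0]) hle
      hs.summable).tsum_le_tsum hle hs.summable
  have hterm : ∀ i ∈ Finset.range N, n₀ ≤ i + 1 → M n / n * u ((i + 1 : ℕ) : ℤ) ≤
      ρ * B * (n : ℝ) ^ (-(1 - β)) * ((i + 1 : ℕ) : ℝ) ^ (-β) := by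
    intro i hi hin
    have hi' : i + 1 ≤ n := (Finset.mem_range.1 hi).trans_le hNn
    have hip : (0 : ℝ) < ((i + 1 : ℕ) : ℝ) := by positivity
    have h1 : M n * u ((i + 1 : ℕ) : ℤ) ≤ ρ * ((n : ℝ) / ((i + 1 : ℕ) : ℝ)) ^ β * B := by
      calc M n * u ((i + 1 : ℕ) : ℤ)
          ≤ (ρ * ((n : ℝ) / ((i + 1 : ℕ) : ℝ)) ^ β * M (i + 1)) * u ((i + 1 : ℕ) : ℤ) :=
            mul_le_mul_of_nonneg_right (hpow _ _ hin hi') (hu0 _)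
        _ = ρ * ((n : ℝ) / ((i + 1 : ℕ) : ℝ)) ^ β * (u ((i + 1 : ℕ) : ℤ) * M (i + 1)) := by ring
        _ ≤ _ := mul_le_mul_of_nonneg_left (hB _) (by positivity)
    rw [div_mul_eq_mul_div, div_le_iff₀ hn0']
    refine h1.trans (le_of_eq ?_)
    rw [Real.div_rpow hn0'.le hip.le, neg_sub, Real.rpow_sub_one hn0'.ne', Real.rpow_neg hip.le]
    field_simp
  have hsum : M n / n * ∑ i ∈ Finset.range N with n₀ ≤ i + 1, u ((i + 1 : ℕ) : ℤ) ≤ ε / 2 := by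
    rw [Finset.mul_sum]
    calc _ ≤ ∑ i ∈ Finset.range N with n₀ ≤ i + 1,
            ρ * B * (n : ℝ) ^ (-(1 - β)) * ((i + 1 : ℕ) : ℝ) ^ (-β) :=
          Finset.sum_le_sum fun i hi => hterm i (Finset.mem_filter.1 hi).1 (Finset.mem_filter.1 hi).2
      _ ≤ ∑ i ∈ Finset.range N, ρ * B * (n : ℝ) ^ (-(1 - β)) * ((i + 1 : ℕ) : ℝ) ^ (-β) :=
          Finset.sum_le_sum_of_subset_of_nonneg (Finset.filter_subset _ _)
            fun i _ _ => by positivity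
      _ = ρ * B * (n : ℝ) ^ (-(1 - β)) * ∑ i ∈ Finset.range N, ((i + 1 : ℕ) : ℝ) ^ (-β) := by
          rw [Finset.mul_sum]
      _ ≤ ρ * B * (n : ℝ) ^ (-(1 - β)) * ((δ * n) ^ (1 - β) / (1 - β)) := by
          gcongr
          refine (sum_rpow_neg_le hβ0 hβ1 N).trans ?_
          gcongr
      _ = ρ * B / (1 - β) * δ ^ (1 - β) := by
          rw [Real.mul_rpow hδ0.le hn0'.le, Real.rpow_neg hn0'.le]
          have : (n : ℝ) ^ (1 - β) ≠ 0 := (Real.rpow_pos_of_pos hn0' _).ne'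
          field_simp
      _ ≤ ε / 2 := hδ.le
  calc _ ≤ M n / n * (V + ∑ i ∈ Finset.range N with n₀ ≤ i + 1, u ((i + 1 : ℕ) : ℤ)) :=
        mul_le_mul_of_nonneg_left hsplit (div_nonneg (hM0 n) hn0'.le)
    _ ≤ ε := by rw [mul_add]; linarith

lemma le_add_mul_of_step {M : ℕ → ℝ} {h : ℝ} (hstep : ∀ n, M (n + 1) ≤ M n + h) {k n : ℕ}
    (hkn : k ≤ n) : M n ≤ M k + ((n : ℝ) - k) * h := by
  induction n, hkn using Nat.le_induction with
  | base => simp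
  | succ n _ ih => push_cast; linarith [hstep n]

/-- Key renewal theorem for sequences: if `u n * M n → c` for a slowly increasing divergent
normalisation `M` whose doubling constant is below `2`, the limit passes through convolution with
a summable `w` with `w j = O(1/j)`. -/
theorem tendsto_mul_tsum_of_doubling {u : ℤ → ℝ} (hu0 : ∀ k, 0 ≤ u k)
    (hneg : ∀ N : ℕ, Summable fun k : ℤ => if k ≤ N then u k else 0)
    {M : ℕ → ℝ} (hM : Monotone M) (hM0 : ∀ n, 0 ≤ M n) (hMtop : Tendsto M atTop atTop)
    {h : ℝ} (hh : 0 ≤ h) (hstep : ∀ n, M (n + 1) ≤ M n + h)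
    {ρ : ℝ} (hρ : 1 ≤ ρ) (hρ2 : ρ < 2) {n₀ : ℕ} (hn₀ : 0 < n₀)
    (hd : ∀ n, n₀ ≤ n → M (2 * n) ≤ ρ * M n) {c : ℝ}
    (hc : Tendsto (fun n : ℕ => u n * M n) atTop (𝓝 c))
    {w : ℤ → ℝ} (hw : Summable fun j => |w j|) {C : ℝ} (hC : 0 ≤ C) {j₀ : ℕ}
    (hwC : ∀ j : ℤ, j₀ ≤ j → (j : ℝ) * |w j| ≤ C) :
    (∀ᶠ n : ℕ in atTop, Summable fun k : ℤ => u k * w (n - k)) ∧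
    Tendsto (fun n : ℕ => M n * ∑' k : ℤ, u k * w (n - k)) atTop (𝓝 (c * ∑' j, w j)) := by
  obtain ⟨B, hB⟩ : ∃ B, ∀ n : ℕ, u n * M n ≤ B := by
    obtain ⟨B, hB⟩ := hc.bddAbove_range
    exact ⟨B, fun n => hB ⟨n, rfl⟩⟩
  have hB0 : 0 ≤ B := (mul_nonneg (hu0 _) (hM0 0)).trans (hB 0)
  have huz : Tendsto (fun n : ℕ => u n) atTop (𝓝 0) := by
    refine (hc.div_atTop hMtop).congr' ?_
    filter_upwards [hMtop.eventually_gt_atTop 0] with n hn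
    rw [mul_div_assoc, div_self hn.ne', mul_one]
  have hsmall : ∀ (δ : ℝ) (n : ℕ), Summable fun k : ℤ => if (k : ℝ) < δ * n then u k else 0 := by
    intro δ n
    refine Summable.of_nonneg_of_le (fun k => by split_ifs <;> simp [hu0]) (fun k => ?_)
      (hneg ⌈δ * n⌉₊)
    by_cases hk : (k : ℝ) < δ * n
    · rw [if_pos hk, if_pos]
      have : (k : ℝ) ≤ (⌈δ * n⌉₊ : ℝ) := hk.le.trans (Nat.le_ceil _)
      exact_mod_cast this
    · rw [if_neg hk]; split_ifs <;> simp [hu0]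
  have hwn : ∀ n : ℕ, Summable fun k : ℤ => |w (n - k)| := fun n =>
    (Equiv.subLeft (n : ℤ)).summable_iff.2 hw
  -- the range `k < δ n`
  have hfar : ∀ δ : ℝ, δ ≤ 1 / 2 → ∀ᶠ n : ℕ in atTop, ∀ k : ℤ,
      |if (k : ℝ) < δ * n then u k * w (n - k) else 0| ≤
        2 * C / n * (if (k : ℝ) < δ * n then u k else 0) := by
    intro δ hδ2
    filter_upwards [eventually_ge_atTop (2 * j₀), eventually_gt_atTop 0] with n hn hn0 k
    have hn0' : (0 : ℝ) < n := by exact_mod_cast hn0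
    by_cases hk : (k : ℝ) < δ * n
    · rw [if_pos hk, if_pos hk, abs_mul, abs_of_nonneg (hu0 k), mul_comm]
      gcongr
      · exact hu0 k
      have h1 : (n : ℝ) / 2 ≤ ((n - k : ℤ) : ℝ) := by push_cast; nlinarith
      have h2 : (j₀ : ℤ) ≤ n - k := by
        have : (2 : ℝ) * j₀ ≤ n := by exact_mod_cast hn
        have : (j₀ : ℝ) ≤ ((n - k : ℤ) : ℝ) := by linarith
        exact_mod_cast this
      rw [le_div_iff₀ hn0']
      nlinarith [hwC _ h2, abs_nonneg (w (n - k))]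
    · rw [if_neg hk, if_neg hk]; simp
  have hfarsum : ∀ δ : ℝ, δ ≤ 1 / 2 → ∀ᶠ n : ℕ in atTop,
      Summable fun k : ℤ => if (k : ℝ) < δ * n then u k * w (n - k) else 0 := by
    intro δ hδ2
    filter_upwards [hfar δ hδ2] with n hn
    exact Summable.of_norm_bounded ((hsmall δ n).mul_left _) hn
  -- the range `k ≥ δ n`
  have hnear : ∀ δ : ℝ, 0 < δ → ∃ K : ℝ, ∀ᶠ n : ℕ in atTop, ∀ k : ℤ,
      |M n * if (k : ℝ) < δ * n then 0 else u k * w (n - k)| ≤ K * |w (n - k)| := by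
    intro δ hδ
    set β := Real.logb 2 ρ
    have hβ0 : 0 ≤ β := Real.logb_nonneg (by norm_num) hρ
    set D := max 1 (ρ * (1 / δ) ^ β) with hD
    refine ⟨D * B, ?_⟩
    have h1 : Tendsto (fun n : ℕ => δ * (n : ℝ)) atTop atTop :=
      tendsto_natCast_atTop_atTop.const_mul_atTop hδ
    filter_upwards [h1.eventually_ge_atTop (n₀ : ℝ)] with n hn k
    by_cases hk : (k : ℝ) < δ * n
    · rw [if_pos hk]; simp; positivity
    rw [if_neg hk]
    push Not at hk
    have hk0 : (0 : ℝ) ≤ k := (by positivity : (0 : ℝ) ≤ δ * n).trans hk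
    lift k to ℕ using (by exact_mod_cast hk0)
    simp only [Int.cast_natCast] at hk hk0
    have hk1 : n₀ ≤ k := by exact_mod_cast hn.trans hk
    have hMk : M n ≤ D * M k := by
      rcases le_total n k with hnk | hkn
      · calc M n ≤ 1 * M k := by rw [one_mul]; exact hM hnk
          _ ≤ D * M k := mul_le_mul_of_nonneg_right (le_max_left _ _) (hM0 k)
      · refine (le_rpow_mul_of_doubling hM hM0 hρ hn₀ hd hk1 hkn).trans ?_
        refine mul_le_mul_of_nonneg_right (le_trans ?_ (le_max_right _ _)) (hM0 k)
        have hkp : (0 : ℝ) < k := by exact_mod_cast hn₀.trans_le hk1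
        have hdiv : (n : ℝ) / k ≤ 1 / δ := by
          rw [div_le_div_iff₀ hkp hδ]
          linarith
        gcongr
    rw [← mul_assoc, abs_mul, abs_of_nonneg (mul_nonneg (hM0 n) (hu0 _))]
    refine mul_le_mul_of_nonneg_right ?_ (abs_nonneg _)
    calc M n * u k ≤ D * M k * u k := mul_le_mul_of_nonneg_right hMk (hu0 _)
      _ = D * (u k * M k) := by ring
      _ ≤ D * B := mul_le_mul_of_nonneg_left (hB k) (by positivity)
  have hnearsum : ∀ δ : ℝ, 0 < δ → ∀ᶠ n : ℕ in atTop,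
      Summable fun k : ℤ => if (k : ℝ) < δ * n then 0 else u k * w (n - k) := by
    intro δ hδ
    obtain ⟨K, hK⟩ := hnear δ hδ
    filter_upwards [hK, hMtop.eventually_gt_atTop 0] with n hn hMn
    exact (summable_mul_left_iff hMn.ne').1
      (Summable.of_norm_bounded ((hwn n).mul_left K) fun k => by
        simpa only [Real.norm_eq_abs] using hn k)
  have hadd : ∀ (δ : ℝ) (n : ℕ) (k : ℤ), u k * w (n - k) =
      (if (k : ℝ) < δ * n then u k * w (n - k) else 0) +
      (if (k : ℝ) < δ * n then 0 else u k * w (n - k)) := by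
    intro δ n k; split_ifs <;> simp
  refine ⟨?_, ?_⟩
  · filter_upwards [hfarsum (1 / 2) le_rfl, hnearsum (1 / 2) (by norm_num)] with n h1 h2
    exact (h1.add h2).congr fun k => (hadd (1 / 2) n k).symm
  have hpt : ∀ j : ℤ, Tendsto (fun n : ℕ => M n * u (n - j)) atTop (𝓝 c) := by
    intro j
    have hk : Tendsto (fun n : ℕ => ((n : ℤ) - j).toNat) atTop atTop := by
      refine tendsto_atTop.2 fun b => ?_
      filter_upwards [eventually_ge_atTop (b + j.natAbs)] with n hn
      omega
    have h1 := hc.comp hk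
    have h2 : Tendsto (fun n : ℕ => (M n - M ((n : ℤ) - j).toNat) * u (((n : ℤ) - j).toNat : ℕ))
        atTop (𝓝 0) := by
      refine bdd_le_mul_tendsto_zero' (|(j : ℝ)| * h) ?_ (huz.comp hk)
      filter_upwards [eventually_ge_atTop j.natAbs] with n hn
      have hcast : ((((n : ℤ) - j).toNat : ℕ) : ℝ) = n - j := by
        have : ((((n : ℤ) - j).toNat : ℕ) : ℤ) = n - j := Int.toNat_of_nonneg (by omega)
        exact_mod_cast this
      rcases le_total ((n : ℤ) - j).toNat n with hle | hle
      · rw [abs_of_nonneg (sub_nonneg.2 (hM hle))]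
        have := le_add_mul_of_step hstep hle
        rw [hcast] at this
        nlinarith [le_abs_self (j : ℝ)]
      · rw [abs_of_nonpos (sub_nonpos.2 (hM hle))]
        have := le_add_mul_of_step hstep hle
        rw [hcast] at this
        nlinarith [neg_abs_le (j : ℝ)]
    have h3 := h1.add h2
    rw [add_zero] at h3
    refine h3.congr' ?_
    filter_upwards [eventually_ge_atTop j.natAbs] with n hn
    have : ((((n : ℤ) - j).toNat : ℕ) : ℤ) = n - j := Int.toNat_of_nonneg (by omega)
    simp only [Function.comp_apply, this]
    ring
  have hmain : ∀ δ : ℝ, 0 < δ → δ ≤ 1 / 2 → Tendsto (fun n : ℕ =>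
      M n * ∑' k : ℤ, if (k : ℝ) < δ * n then 0 else u k * w (n - k)) atTop
      (𝓝 (c * ∑' j, w j)) := by
    intro δ hδ hδ2
    obtain ⟨K, hK⟩ := hnear δ hδ
    have h1 := tendsto_tsum_of_dominated_convergence (𝓕 := atTop) (bound := fun j => K * |w j|)
      (f := fun (n : ℕ) (j : ℤ) => M n *
        if (((n : ℤ) - j : ℤ) : ℝ) < δ * n then 0 else u (n - j) * w j)
      (g := fun j => c * w j) (hw.mul_left K) ?_ ?_
    · rw [tsum_mul_left] at h1
      refine h1.congr fun n => ?_
      rw [tsum_mul_left]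
      congr 1
      rw [← (Equiv.subLeft (n : ℤ)).tsum_eq]
      refine tsum_congr fun k => ?_
      simp
    · intro j
      refine ((hpt j).mul_const (w j)).congr' ?_
      filter_upwards [eventually_ge_atTop (2 * j.natAbs)] with n hn
      rw [if_neg]
      · ring
      · rw [not_lt]
        have h2 : (2 : ℝ) * j ≤ n := by
          have : 2 * j ≤ n := by omega
          exact_mod_cast this
        push_cast
        nlinarith [(Nat.cast_nonneg n : (0 : ℝ) ≤ n)]
    · filter_upwards [hK] with n hn j
      have := hn (n - j)
      simpa using this
  rw [Metric.tendsto_atTop']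
  intro ε hε
  obtain ⟨δ, hδ, hδ2, hδε⟩ := exists_eventually_tsum_le hu0 hneg hM hM0 hρ hρ2 hn₀ hd hB
    (show 0 < ε / 2 / (2 * C + 1) by positivity)
  have h1 := Metric.tendsto_nhds.1 (hmain δ hδ hδ2) (ε / 2) (half_pos hε)
  obtain ⟨N, hN⟩ := eventually_atTop.1 (h1.and (hδε.and ((hfar δ hδ2).and
    ((hfarsum δ hδ2).and (hnearsum δ hδ)))))
  refine ⟨N, fun n hn => ?_⟩
  obtain ⟨h1, h2, h3, h4, h5⟩ := hN n hn.le
  rw [tsum_congr (hadd δ n), h4.tsum_add h5, mul_add]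
  have h6 : |M n * ∑' k : ℤ, if (k : ℝ) < δ * n then u k * w (n - k) else 0| < ε / 2 := by
    rw [abs_mul, abs_of_nonneg (hM0 n)]
    have h7 : |∑' k : ℤ, if (k : ℝ) < δ * n then u k * w (n - k) else 0| ≤
        2 * C / n * ∑' k : ℤ, if (k : ℝ) < δ * n then u k else 0 :=
      tsum_of_norm_bounded (f := fun k : ℤ => if (k : ℝ) < δ * n then u k * w (n - k) else 0)
        ((hsmall δ n).hasSum.mul_left _) h3
    calc _ ≤ M n * (2 * C / n * ∑' k : ℤ, if (k : ℝ) < δ * n then u k else 0) :=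
          mul_le_mul_of_nonneg_left h7 (hM0 n)
      _ = 2 * C * (M n / n * ∑' k : ℤ, if (k : ℝ) < δ * n then u k else 0) := by ring
      _ ≤ 2 * C * (ε / 2 / (2 * C + 1)) := by gcongr
      _ < ε / 2 := by
          rw [mul_div_assoc', div_lt_iff₀ (by positivity)]
          nlinarith
  rw [Real.dist_eq] at h1 ⊢
  rw [abs_lt] at *
  constructor <;> linarith [h1.1, h1.2, h6.1, h6.2]

lemma Antitone.integral_sub_le {G : ℝ → ℝ} (hG : Antitone G) (hG1 : ∀ x, G x ≤ 1) {a b : ℝ}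
    (hab : a ≤ b) : ∫ y in a..b, G y ≤ b - a := by
  have := intervalIntegral.integral_mono_on hab (hG.intervalIntegrable)
    (intervalIntegrable_const (c := (1 : ℝ)) (μ := volume)) (fun y _ => hG1 y)
  simpa using this

/-- If `G (2 y) ≤ r * G y` eventually with `r < 1`, the truncated integral of `G` has a doubling
constant below `2`. -/
lemma exists_doubling_of_antitone {G : ℝ → ℝ} (hG : Antitone G) (hG0 : ∀ x, 0 ≤ G x)
    (hG1 : ∀ x, G x ≤ 1) {r : ℝ} (hr0 : 0 ≤ r) (hr : r < 1)
    (hGr : ∀ᶠ y in atTop, G (2 * y) ≤ r * G y)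
    (htop : Tendsto (fun x => ∫ y in (0 : ℝ)..x, G y) atTop atTop) :
    ∀ᶠ x in atTop, ∫ y in (0 : ℝ)..(2 * x), G y ≤ (1 + r) * ∫ y in (0 : ℝ)..x, G y := by
  obtain ⟨y₀, hy₀⟩ := eventually_atTop.1 (hGr.and (eventually_ge_atTop 0))
  have hy0 : 0 ≤ y₀ := (hy₀ y₀ le_rfl).2
  have hint : ∀ a b : ℝ, IntervalIntegrable G volume a b := fun a b => hG.intervalIntegrable
  have hG2 : Antitone fun y => G (2 * y) := fun a b hab => hG (by linarith)
  have hint2 : ∀ a b : ℝ, IntervalIntegrable (fun y => G (2 * y)) volume a b :=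
    fun a b => hG2.intervalIntegrable
  filter_upwards [eventually_ge_atTop y₀, htop.eventually_ge_atTop (2 * y₀ / (1 - r))]
    with x hx hmx
  rw [div_le_iff₀ (by linarith)] at hmx
  have e : ∫ y in (0 : ℝ)..(2 * x), G y = 2 * ∫ y in (0 : ℝ)..x, G (2 * y) := by
    rw [intervalIntegral.mul_integral_comp_mul_left, mul_zero]
  rw [e, ← intervalIntegral.integral_add_adjacent_intervals (hint2 0 y₀) (hint2 y₀ x)]
  have h1 : ∫ y in (0 : ℝ)..y₀, G (2 * y) ≤ y₀ := by
    simpa using hG2.integral_sub_le (fun x => hG1 _) hy0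
  have h2 : ∫ y in y₀..x, G (2 * y) ≤ r * ∫ y in y₀..x, G y := by
    rw [← intervalIntegral.integral_const_mul]
    exact intervalIntegral.integral_mono_on hx (hint2 _ _) ((hint _ _).const_mul r)
      fun y hy => (hy₀ y hy.1).1
  have h3 : ∫ y in y₀..x, G y ≤ ∫ y in (0 : ℝ)..x, G y := by
    rw [← intervalIntegral.integral_add_adjacent_intervals (hint 0 y₀) (hint y₀ x)]
    linarith [intervalIntegral.integral_nonneg hy0 (f := G) (μ := volume) fun y _ => hG0 y]
  nlinarith

lemma monotone_integral_of_nonneg {G : ℝ → ℝ} (hG : Antitone G) (hG0 : ∀ x, 0 ≤ G x) (a : ℝ) :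
    Monotone fun x => ∫ y in a..x, G y := by
  intro x y hxy
  have hint : ∀ a b : ℝ, IntervalIntegrable G volume a b := fun a b => hG.intervalIntegrable
  show ∫ y in a..x, G y ≤ ∫ y in a..y, G y
  rw [← intervalIntegral.integral_add_adjacent_intervals (hint a x) (hint x y)]
  linarith [intervalIntegral.integral_nonneg hxy (f := G) (μ := volume) fun y _ => hG0 y]

/-- If `G (2 y) ≥ r * G y > 0` eventually with `r > 1 / 2`, then `G` is not integrable at `∞`. -/
lemma tendsto_integral_atTop_of_antitone {G : ℝ → ℝ} (hG : Antitone G) (hG0 : ∀ x, 0 ≤ G x)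
    {r : ℝ} (hr : 1 / 2 < r) (hGr : ∀ᶠ y in atTop, 0 < G y ∧ r * G y ≤ G (2 * y)) :
    Tendsto (fun x => ∫ y in (0 : ℝ)..x, G y) atTop atTop := by
  obtain ⟨y₀, hy₀⟩ := eventually_atTop.1 (hGr.and (eventually_ge_atTop 0))
  have hy0 : 0 ≤ y₀ := (hy₀ y₀ le_rfl).2
  have hint : ∀ a b : ℝ, IntervalIntegrable G volume a b := fun a b => hG.intervalIntegrable
  have hG2 : Antitone fun y => G (2 * y) := fun a b hab => hG (by linarith)
  have hdouble : ∀ x, y₀ ≤ x → 2 * r * ∫ y in y₀..x, G y ≤ ∫ y in y₀..(2 * x), G y := by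
    intro x hx
    have h1 : r * ∫ y in y₀..x, G y ≤ ∫ y in y₀..x, G (2 * y) := by
      rw [← intervalIntegral.integral_const_mul]
      exact intervalIntegral.integral_mono_on hx ((hint _ _).const_mul r)
        hG2.intervalIntegrable fun y hy => (hy₀ y hy.1).1.2
    have h2 : 2 * ∫ y in y₀..x, G (2 * y) = ∫ y in (2 * y₀)..(2 * x), G y :=
      intervalIntegral.mul_integral_comp_mul_left _
    have h3 := intervalIntegral.integral_add_adjacent_intervals (hint y₀ (2 * y₀))
      (hint (2 * y₀) (2 * x))
    have h4 := intervalIntegral.integral_nonneg (a := y₀) (b := 2 * y₀) (by linarith) (f := G)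
      (μ := volume) fun y _ => hG0 y
    linarith
  set I := ∫ y in y₀..(y₀ + 1), G y with hI
  have hIpos : 0 < I := by
    have h1 := intervalIntegral.integral_mono_on (show y₀ ≤ y₀ + 1 by linarith)
      (intervalIntegrable_const (c := G (y₀ + 1)) (μ := volume)) (hint _ _)
      fun y hy => hG hy.2
    have h2 := (hy₀ (y₀ + 1) (by linarith)).1.1
    simp at h1
    linarith
  have hiter : ∀ n : ℕ, (2 * r) ^ n * I ≤ ∫ y in y₀..(2 ^ n * (y₀ + 1)), G y := by
    intro n
    induction n with
    | zero => simp [hI]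
    | succ n ih =>
      have h1 : y₀ ≤ 2 ^ n * (y₀ + 1) := by
        nlinarith [one_le_pow₀ (one_le_two : (1 : ℝ) ≤ 2) (n := n)]
      calc (2 * r) ^ (n + 1) * I = 2 * r * ((2 * r) ^ n * I) := by ring
        _ ≤ 2 * r * ∫ y in y₀..(2 ^ n * (y₀ + 1)), G y := by gcongr
        _ ≤ _ := hdouble _ h1
        _ = _ := by rw [← mul_assoc, ← pow_succ']
  refine tendsto_atTop_atTop_of_monotone (monotone_integral_of_nonneg hG hG0 0) fun b => ?_
  obtain ⟨n, hn⟩ := pow_unbounded_of_one_lt (b / I) (show 1 < 2 * r by linarith)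
  rw [div_lt_iff₀ hIpos] at hn
  refine ⟨2 ^ n * (y₀ + 1), ?_⟩
  have h3 := intervalIntegral.integral_add_adjacent_intervals (hint 0 y₀)
    (hint y₀ (2 ^ n * (y₀ + 1)))
  have h4 := intervalIntegral.integral_nonneg hy0 (f := G) (μ := volume) fun y _ => hG0 y
  linarith [hiter n]

/-- A probability measure on `ℝ` with infinite mean of the positive part has a non-integrable
tail. -/
lemma tendsto_integral_tail_atTop {μ : Measure ℝ} [IsProbabilityMeasure μ]
    (hμ : ∫⁻ y, ENNReal.ofReal y ∂μ = ⊤) :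
    Tendsto (fun x => ∫ y in (0 : ℝ)..x, (1 - (μ (Set.Iic y)).toReal)) atTop atTop := by
  set G : ℝ → ℝ := fun y => 1 - (μ (Set.Iic y)).toReal with hGdef
  have hG : Antitone G := fun a b hab => by
    have : (μ (Set.Iic a)).toReal ≤ (μ (Set.Iic b)).toReal :=
      ENNReal.toReal_mono (measure_ne_top _ _) (measure_mono (Set.Iic_subset_Iic.2 hab))
    simp only [hGdef]; linarith
  have hGeq : ∀ y, G y = (μ (Set.Ioi y)).toReal := fun y => by
    have := prob_compl_eq_one_sub (μ := μ) (measurableSet_Iic (a := y))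
    rw [Set.compl_Iic] at this
    rw [this, ENNReal.toReal_sub_of_le prob_le_one ENNReal.one_ne_top]; simp [hGdef]
  have hG0 : ∀ y, 0 ≤ G y := fun y => by rw [hGeq]; exact ENNReal.toReal_nonneg
  rcases tendsto_atTop_of_monotone (monotone_integral_of_nonneg hG hG0 0) with h | ⟨l, hl⟩
  · exact h
  exfalso
  have hbdd : ∀ x, ∫ y in (0 : ℝ)..x, G y ≤ l :=
    (monotone_integral_of_nonneg hG hG0 0).ge_of_tendsto hl
  have hint : IntegrableOn G (Set.Ioi 0) := by
    refine integrableOn_Ioi_of_intervalIntegral_norm_bounded l 0 (b := fun x : ℝ => x) (l := atTop)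
      (fun i => ?_) tendsto_id (Eventually.of_forall fun x => ?_)
    · exact (hG.intervalIntegrable (a := 0) (b := i)).1
    · simpa [abs_of_nonneg (hG0 _)] using hbdd x
  have hlc : ∫⁻ y, ENNReal.ofReal y ∂μ = ∫⁻ t in Set.Ioi 0, ENNReal.ofReal (G t) := by
    have h1 := lintegral_eq_lintegral_meas_lt μ (f := fun y : ℝ => max y 0)
      (Eventually.of_forall fun y => le_max_right _ _) (by fun_prop)
    calc ∫⁻ y, ENNReal.ofReal y ∂μ = ∫⁻ y, ENNReal.ofReal (max y 0) ∂μ := by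
          refine lintegral_congr fun y => ?_
          rcases le_total y 0 with hy | hy
          · rw [max_eq_right hy, ENNReal.ofReal_of_nonpos hy, ENNReal.ofReal_zero]
          · rw [max_eq_left hy]
      _ = _ := h1
      _ = _ := by
          refine setLIntegral_congr_fun measurableSet_Ioi fun t ht => ?_
          have : {a : ℝ | t < max a 0} = Set.Ioi t := by
            ext a
            simp [not_lt.2 (le_of_lt (Set.mem_Ioi.1 ht))]
          simp only [this]
          rw [hGeq, ENNReal.ofReal_toReal (measure_ne_top _ _)]
  rw [hμ] at hlc
  exact absurd hlc.symm (hint.lintegral_lt_top).ne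

/-- Measures concentrated on an additively closed set are closed under convolution. -/
lemma mconv_compl_eq_zero {μ ν : Measure ℝ} [SFinite ν] {S : Set ℝ} (hS : MeasurableSet S)
    (hadd : ∀ a ∈ S, ∀ b ∈ S, a + b ∈ S) (hμ : μ Sᶜ = 0) (hν : ν Sᶜ = 0) :
    mconv μ ν Sᶜ = 0 := by
  rw [mconv, Measure.map_apply (by fun_prop) hS.compl]
  have h1 : (fun p : ℝ × ℝ => p.1 + p.2) ⁻¹' Sᶜ ⊆ Sᶜ ×ˢ Set.univ ∪ Set.univ ×ˢ Sᶜ := by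
    rintro ⟨a, b⟩ hab
    by_contra hcon
    simp only [Set.mem_union, Set.mem_prod, Set.mem_compl_iff, Set.mem_univ, and_true, true_and,
      not_or, not_not] at hcon
    exact hab (hadd a hcon.1 b hcon.2)
  refine measure_mono_null h1 (measure_union_null ?_ ?_)
  · rw [Measure.prod_prod, hμ, zero_mul]
  · rw [Measure.prod_prod, hν, mul_zero]

lemma renewalMeasure_compl_eq_zero {μ : Measure ℝ} [SFinite μ] {S : Set ℝ} (hS : MeasurableSet S)
    (hS0 : (0 : ℝ) ∈ S) (hadd : ∀ a ∈ S, ∀ b ∈ S, a + b ∈ S) (hμ : μ Sᶜ = 0) :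
    renewalMeasure μ Sᶜ = 0 := by
  rw [renewalMeasure, Measure.sum_apply _ hS.compl, ENNReal.tsum_eq_zero]
  intro n
  induction n with
  | zero => simp [convPow, Measure.dirac_apply' _ hS.compl, hS0]
  | succ n ih => exact mconv_compl_eq_zero hS hadd ih hμ

lemma integral_eq_tsum_of_embedding {ι α : Type*} [MeasurableSpace α] [Countable ι]
    [MeasurableSpace ι] [MeasurableSingletonClass ι] {φ : ι → α} (hφ : MeasurableEmbedding φ)
    {μ : Measure α} (hμ : μ (Set.range φ)ᶜ = 0) (hfin : ∀ i, μ {φ i} ≠ ⊤) {f : α → ℝ}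
    (hf : Summable fun i => (μ {φ i}).toReal * f (φ i)) :
    ∫ y, f y ∂μ = ∑' i, (μ {φ i}).toReal * f (φ i) := by
  have hmap : (μ.comap φ).map φ = μ := by
    rw [hφ.map_comap]
    exact Measure.restrict_eq_self_of_ae_mem (measure_eq_zero_iff_ae_notMem.1 hμ |>.mono
      fun x hx => not_not.1 hx)
  have hsing : ∀ i, (μ.comap φ) {i} = μ {φ i} := fun i => by
    rw [hφ.comap_apply, Set.image_singleton]
  have hint : Integrable (fun i => f (φ i)) (μ.comap φ) := by
    refine ⟨(measurable_of_countable _).aestronglyMeasurable, ?_⟩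
    rw [HasFiniteIntegral, lintegral_countable']
    have : ∀ i, ‖f (φ i)‖ₑ * (μ.comap φ) {i} =
        ENNReal.ofReal ‖(μ {φ i}).toReal * f (φ i)‖ := fun i => by
      rw [hsing, norm_mul, Real.norm_of_nonneg ENNReal.toReal_nonneg,
        ENNReal.ofReal_mul ENNReal.toReal_nonneg, ENNReal.ofReal_toReal (hfin i),
        ofReal_norm, mul_comm]
    rw [tsum_congr this]
    exact hf.norm.tsum_ofReal_lt_top
  calc ∫ y, f y ∂μ = ∫ y, f y ∂((μ.comap φ).map φ) := by rw [hmap]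
    _ = ∫ i, f (φ i) ∂(μ.comap φ) := hφ.integral_map _
    _ = ∑' i, (μ.comap φ).real {i} • f (φ i) := integral_countable hint
    _ = _ := by simp only [Measure.real, hsing, smul_eq_mul]

lemma measurableEmbedding_intCast_mul {h : ℝ} (hh : h ≠ 0) :
    MeasurableEmbedding fun k : ℤ => (k : ℝ) * h :=
  (measurable_of_countable _).measurableEmbedding fun a b hab => by
    simpa [hh] using hab

lemma isProbabilityMeasure_tiltedLog {Ω : Type*} [MeasurableSpace Ω] {P : Measure Ω}
    {A : Ω → ℝ} (hA : Measurable A) (hA0 : ∀ᵐ ω ∂P, 0 ≤ A ω) {κ : ℝ}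
    (hE : ∫ ω, A ω ^ κ ∂P = 1) : IsProbabilityMeasure (tiltedLog P A κ) := by
  have hint : Integrable (fun ω => A ω ^ κ) P := by
    by_contra hcon
    rw [integral_undef hcon] at hE
    exact zero_ne_one hE
  have : IsProbabilityMeasure (P.withDensity fun ω => ENNReal.ofReal (A ω ^ κ)) := by
    constructor
    rw [withDensity_apply _ MeasurableSet.univ, Measure.restrict_univ,
      ← ofReal_integral_eq_lintegral_ofReal hint
        (hA0.mono fun ω hω => Real.rpow_nonneg hω κ), hE, ENNReal.ofReal_one]
  exact Measure.isProbabilityMeasure_map hA.log.aemeasurable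

lemma tiltedLog_compl_range_eq_zero {Ω : Type*} [MeasurableSpace Ω] {P : Measure Ω}
    {A : Ω → ℝ} (hA : Measurable A) {κ h : ℝ} (hspan : CondLogArithSpan P A h) :
    tiltedLog P A κ (Set.range fun k : ℤ => (k : ℝ) * h)ᶜ = 0 := by
  rw [tiltedLog, Measure.map_apply hA.log
    (Set.countable_range _).measurableSet.compl]
  refine withDensity_absolutelyContinuous P _ (measure_mono_null ?_ hspan.2.1)
  intro ω hω
  refine ⟨fun h0 => hω ⟨0, by simp [h0]⟩, fun k hk => hω ⟨k, hk.symm⟩⟩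

/-- If `u_n m_n` has a positive limit, with `u_n` computed from real-valued distribution
functions, the measure is finite on left half-lines. -/
lemma measure_Iic_ne_top_of_tendsto {μ : Measure ℝ} {h : ℝ} (hh : 0 < h) {M : ℕ → ℝ}
    (hM0 : ∀ n, 0 ≤ M n) {c : ℝ} (hc0 : 0 < c)
    (hc : Tendsto (fun n : ℕ => ((μ (Set.Iic ((n : ℝ) * h))).toReal -
      (μ (Set.Iio ((n : ℝ) * h))).toReal) * M n) atTop (𝓝 c)) (x : ℝ) :
    μ (Set.Iic x) ≠ ⊤ := by
  have h1 : ∀ᶠ n : ℕ in atTop, x ≤ n * h :=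
    (tendsto_natCast_atTop_atTop.atTop_mul_const hh).eventually_ge_atTop x
  obtain ⟨n, hpos, hx⟩ := ((hc.eventually (lt_mem_nhds hc0)).and h1).exists
  intro htop
  have h2 : μ (Set.Iic ((n : ℝ) * h)) = ⊤ :=
    top_le_iff.1 (htop.symm.le.trans (measure_mono (Set.Iic_subset_Iic.2 hx)))
  rw [h2, ENNReal.toReal_top, zero_sub] at hpos
  have := mul_nonneg (ENNReal.toReal_nonneg (a := μ (Set.Iio ((n : ℝ) * h)))) (hM0 n)
  linarith

lemma toReal_Iic_sub_toReal_Iio {μ : Measure ℝ} {x : ℝ} (hx : μ (Set.Iic x) ≠ ⊤) :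
    (μ (Set.Iic x)).toReal - (μ (Set.Iio x)).toReal = (μ {x}).toReal := by
  have h1 : μ (Set.Iic x) = μ (Set.Iio x) + μ {x} := by
    rw [← measure_union (by simp) (measurableSet_singleton x), Set.Iio_union_right]
  rw [h1] at hx ⊢
  rw [ENNReal.toReal_add (ENNReal.add_ne_top.1 hx).1 (ENNReal.add_ne_top.1 hx).2]
  ring

lemma summable_ite_toReal_singleton {μ : Measure ℝ} {h : ℝ} (hh : 0 < h)
    (hfin : ∀ x, μ (Set.Iic x) ≠ ⊤) (N : ℕ) :
    Summable fun k : ℤ => if k ≤ N then (μ {(k : ℝ) * h}).toReal else 0 := by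
  have hφ := measurableEmbedding_intCast_mul hh.ne'
  have h1 : ∑' k : ℤ, (if k ≤ N then μ {(k : ℝ) * h} else 0) ≤ μ (Set.Iic (N * h)) := by
    have h2 : μ.comap (fun k : ℤ => (k : ℝ) * h) (Set.Iic (N : ℤ)) ≤ μ (Set.Iic (N * h)) := by
      rw [hφ.comap_apply]
      refine measure_mono ?_
      rintro _ ⟨k, hk, rfl⟩
      have : (k : ℝ) ≤ N := by exact_mod_cast Set.mem_Iic.1 hk
      exact mul_le_mul_of_nonneg_right this hh.le
    refine le_trans (le_of_eq ?_) h2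
    rw [← lintegral_indicator_one measurableSet_Iic, lintegral_countable']
    refine tsum_congr fun k => ?_
    rw [hφ.comap_apply, Set.image_singleton, Set.indicator_apply]
    simp only [Set.mem_Iic, Pi.one_apply, ite_mul, one_mul, zero_mul]
  refine (ENNReal.summable_toReal (ne_top_of_le_ne_top (hfin _) h1)).congr fun k => ?_
  split_ifs <;> simp

/-- A function `L x * x ^ (-α)` with `L` slowly varying is regularly varying. -/
lemma SlowlyVarying.tendsto_ratio {L : ℝ → ℝ} (hL : SlowlyVarying L) {α : ℝ} {G : ℝ → ℝ}
    (hG : ∀ x, 0 < x → G x = L x * x ^ (-α)) :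
    Tendsto (fun x => G (2 * x) / G x) atTop (𝓝 ((2 : ℝ) ^ (-α))) := by
  have h1 := (hL 2 two_pos).mul_const ((2 : ℝ) ^ (-α))
  rw [one_mul] at h1
  refine h1.congr' ?_
  filter_upwards [eventually_gt_atTop 0] with x hx
  rw [hG x hx, hG (2 * x) (by linarith), Real.mul_rpow two_pos.le hx.le]
  have : x ^ (-α) ≠ 0 := (Real.rpow_pos_of_pos hx _).ne'
  by_cases hLx : L x = 0
  · simp [hLx]
  · field_simp

lemma tendsto_mFun_atTop_and_doubling {Ω : Type*} [MeasurableSpace Ω] {P : Measure Ω}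
    {A : Ω → ℝ} {κ α : ℝ} [IsProbabilityMeasure (tiltedLog P A κ)]
    (hα0 : 0 < α) (hα1 : α ≤ 1) {L : ℝ → ℝ} (hL : SlowlyVarying L)
    (hFL : ∀ x : ℝ, 0 < x → 1 - Fk P A κ x = L x * x ^ (-α))
    (hinf : α = 1 → (∫⁻ y, ENNReal.ofReal y ∂(tiltedLog P A κ)) = ⊤) :
    Tendsto (fun x => ∫ y in (0 : ℝ)..x, (1 - Fk P A κ y)) atTop atTop ∧
    ∃ ρ : ℝ, 1 ≤ ρ ∧ ρ < 2 ∧ ∀ᶠ x in atTop, ∫ y in (0 : ℝ)..(2 * x), (1 - Fk P A κ y) ≤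
      ρ * ∫ y in (0 : ℝ)..x, (1 - Fk P A κ y) := by
  have hG : Antitone fun y => 1 - Fk P A κ y := fun a b hab =>
    sub_le_sub_left (ENNReal.toReal_mono (measure_ne_top _ _)
      (measure_mono (Set.Iic_subset_Iic.2 hab))) _
  have hG0 : ∀ y, 0 ≤ 1 - Fk P A κ y := fun y => sub_nonneg.2 measureReal_le_one
  have hG1 : ∀ y, 1 - Fk P A κ y ≤ 1 := fun y => sub_le_self _ ENNReal.toReal_nonneg
  have hratio := hL.tendsto_ratio hFL
  have hpos : ∀ᶠ y in atTop, 0 < 1 - Fk P A κ y := by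
    filter_upwards [hratio.eventually (lt_mem_nhds (by positivity : (0 : ℝ) < 2 ^ (-α)))]
      with y hy
    refine lt_of_le_of_ne (hG0 y) fun h0 => ?_
    rw [← h0, div_zero] at hy
    exact lt_irrefl _ hy
  have htop : Tendsto (fun x => ∫ y in (0 : ℝ)..x, (1 - Fk P A κ y)) atTop atTop := by
    rcases hα1.lt_or_eq with hα | hα
    · have h2 : (1 / 2 : ℝ) < 2 ^ (-α) := by
        have := Real.rpow_lt_rpow_of_exponent_lt one_lt_two (neg_lt_neg hα)
        rwa [Real.rpow_neg_one, inv_eq_one_div] at this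
      obtain ⟨r, hr1, hr2⟩ := exists_between h2
      refine tendsto_integral_atTop_of_antitone hG hG0 hr1 ?_
      filter_upwards [hpos, hratio.eventually (lt_mem_nhds hr2)] with y hy hry
      exact ⟨hy, ((lt_div_iff₀ hy).1 hry).le⟩
    · exact tendsto_integral_tail_atTop (hinf hα)
  refine ⟨htop, ?_⟩
  have h2 : (2 : ℝ) ^ (-α) < 1 := Real.rpow_lt_one_of_one_lt_of_neg one_lt_two (neg_lt_zero.2 hα0)
  obtain ⟨r, hr1, hr2⟩ := exists_between h2
  have hr0 : 0 ≤ r := (by positivity : (0 : ℝ) ≤ 2 ^ (-α)).trans hr1.le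
  refine ⟨1 + r, by linarith, by linarith,
    exists_doubling_of_antitone hG hG0 hG1 hr0 hr2 ?_ htop⟩
  filter_upwards [hpos, hratio.eventually (gt_mem_nhds hr1)] with y hy hry
  exact ((div_lt_iff₀ hy).1 hry).le

/-- Lemma 2 (key renewal theorem, infinite mean, arithmetic case): under (A2) and the
strong renewal theorem `u_n m(nh) → h C_α`, for any `z` with `Σ_j |z(x+jh)| < ∞` and
`z(x) = O(x⁻¹)`, `m(nh) ∫ z(x+nh-y) U(dy) → h C_α Σ_j z(x+jh)`. -/
theorem stmt14 {Ω : Type*} [MeasurableSpace Ω] (P : Measure Ω) [IsProbabilityMeasure P]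
    (A : Ω → ℝ) (hAmeas : Measurable A)
    (κ h α : ℝ) (hA2 : AssumptionA2 P A κ h α)
    (Cα : ℝ)
    (hCα : Cα = if α = 1 then 1 else Real.sin (α * Real.pi) / ((1 - α) * Real.pi))
    (hSRT : Tendsto (fun n : ℕ =>
        ((renewalMeasure (tiltedLog P A κ) (Set.Iic ((n : ℝ) * h))).toReal -
          (renewalMeasure (tiltedLog P A κ) (Set.Iio ((n : ℝ) * h))).toReal) *
          mFun P A κ (n * h))
      atTop (𝓝 (h * Cα)))
    (z : ℝ → ℝ)
    (hzsum : ∀ x : ℝ, Summable fun j : ℤ => |z (x + j * h)|)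
    (hzbd : ∃ C : ℝ, ∀ y : ℝ, 0 < y → y * |z y| ≤ C) :
    ∀ x : ℝ, Tendsto (fun n : ℕ =>
        mFun P A κ (n * h) * ∫ y, z (x + n * h - y) ∂(renewalMeasure (tiltedLog P A κ)))
      atTop (𝓝 (h * Cα * ∑' j : ℤ, z (x + j * h))) := by
  intro x
  obtain ⟨-, hA0, hE, hspan, hα0, hα1, ⟨L, hL, hFL⟩, hinf, -⟩ := hA2
  have hh : 0 < h := hspan.1
  have : IsProbabilityMeasure (tiltedLog P A κ) := isProbabilityMeasure_tiltedLog hAmeas hA0 hE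
  obtain ⟨htop, ρ, hρ, hρ2, hdbl⟩ :=
    tendsto_mFun_atTop_and_doubling (P := P) (A := A) (κ := κ) hα0 hα1 hL hFL hinf
  have hG : Antitone fun y => 1 - Fk P A κ y := fun a b hab =>
    sub_le_sub_left (ENNReal.toReal_mono (measure_ne_top _ _)
      (measure_mono (Set.Iic_subset_Iic.2 hab))) _
  have hG0 : ∀ y, 0 ≤ 1 - Fk P A κ y := fun y => sub_nonneg.2 measureReal_le_one
  have hG1 : ∀ y, 1 - Fk P A κ y ≤ 1 := fun y => sub_le_self _ ENNReal.toReal_nonneg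
  have hmI : ∀ n : ℕ, mFun P A κ (n * h) = ∫ y in (0 : ℝ)..(n * h), (1 - Fk P A κ y) := fun n =>
    (intervalIntegral.integral_of_le (by positivity)).symm
  have hnh : Tendsto (fun n : ℕ => (n : ℝ) * h) atTop atTop :=
    tendsto_natCast_atTop_atTop.atTop_mul_const hh
  have hM : Monotone fun n : ℕ => mFun P A κ (n * h) := fun a b hab => by
    simp only [hmI]
    refine monotone_integral_of_nonneg hG hG0 0 ?_
    gcongr
  have hM0 : ∀ n : ℕ, 0 ≤ mFun P A κ (n * h) := fun n =>
    integral_nonneg fun y => hG0 y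
  have hMtop : Tendsto (fun n : ℕ => mFun P A κ (n * h)) atTop atTop := by
    simp only [hmI]
    exact htop.comp hnh
  have hstep : ∀ n : ℕ, mFun P A κ ((n + 1 : ℕ) * h) ≤ mFun P A κ (n * h) + h := fun n => by
    rw [hmI, hmI, ← intervalIntegral.integral_add_adjacent_intervals
      (hG.intervalIntegrable (a := 0) (b := n * h)) hG.intervalIntegrable]
    have := hG.integral_sub_le hG1 (a := n * h) (b := (n + 1 : ℕ) * h)
      (by push_cast; linarith)
    push_cast at this ⊢
    linarith
  obtain ⟨n₀, hn₀⟩ := eventually_atTop.1 (hnh.eventually hdbl)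
  have hd : ∀ n : ℕ, n₀ + 1 ≤ n → mFun P A κ ((2 * n : ℕ) * h) ≤ ρ * mFun P A κ (n * h) := by
    intro n hn
    rw [hmI, hmI]
    have := hn₀ n (by omega)
    rwa [show 2 * ((n : ℝ) * h) = (2 * n : ℕ) * h by push_cast; ring] at this
  have hc0 : 0 < h * Cα := by
    refine mul_pos hh ?_
    rw [hCα]
    split_ifs with h1
    · exact one_pos
    · have hα : α < 1 := lt_of_le_of_ne hα1 h1
      refine div_pos (Real.sin_pos_of_pos_of_lt_pi (by positivity) ?_)
        (mul_pos (by linarith) Real.pi_pos)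
      nlinarith [Real.pi_pos]
  set U := renewalMeasure (tiltedLog P A κ) with hU
  have hfin : ∀ y, U (Set.Iic y) ≠ ⊤ := measure_Iic_ne_top_of_tendsto hh hM0 hc0 hSRT
  have hc : Tendsto (fun n : ℕ => (U {((n : ℤ) : ℝ) * h}).toReal * mFun P A κ (n * h)) atTop
      (𝓝 (h * Cα)) := by
    refine hSRT.congr fun n => ?_
    rw [toReal_Iic_sub_toReal_Iio (hfin _), Int.cast_natCast]
  have hUS : U (Set.range fun k : ℤ => (k : ℝ) * h)ᶜ = 0 := by
    refine renewalMeasure_compl_eq_zero (Set.countable_range _).measurableSet ⟨0, by simp⟩ ?_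
      (tiltedLog_compl_range_eq_zero hAmeas hspan)
    rintro _ ⟨a, rfl⟩ _ ⟨b, rfl⟩
    exact ⟨a + b, by push_cast; ring⟩
  obtain ⟨C, hC⟩ := hzbd
  have hC0 : 0 ≤ C := (by positivity : (0 : ℝ) ≤ 1 * |z 1|).trans (hC 1 one_pos)
  obtain ⟨j₀, hj₀⟩ := eventually_atTop.1
    ((hnh.eventually_ge_atTop (-2 * x)).and (eventually_ge_atTop 1))
  have hwC : ∀ j : ℤ, j₀ ≤ j → (j : ℝ) * |z (x + j * h)| ≤ 2 * C / h := by
    intro j hj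
    lift j to ℕ using (by omega)
    obtain ⟨h1, h2⟩ := hj₀ j (by exact_mod_cast hj)
    have h3 : (0 : ℝ) < j := by exact_mod_cast h2
    have h4 : (0 : ℝ) < j * h := mul_pos h3 hh
    simp only [Int.cast_natCast]
    have h5 := hC (x + j * h) (by linarith)
    rw [le_div_iff₀ hh]
    nlinarith [abs_nonneg (z (x + j * h))]
  obtain ⟨hsum, hlim⟩ := tendsto_mul_tsum_of_doubling
    (u := fun k : ℤ => (U {(k : ℝ) * h}).toReal) (fun k => ENNReal.toReal_nonneg)
    (summable_ite_toReal_singleton hh hfin) hM hM0 hMtop hh.le hstep hρ hρ2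
    n₀.succ_pos hd hc (hzsum x) (by positivity) hwC
  refine hlim.congr' ?_
  filter_upwards [hsum] with n hn
  have harg : ∀ k : ℤ, x + ((n - k : ℤ) : ℝ) * h = x + n * h - k * h := fun k => by
    push_cast; ring
  simp only [harg] at hn ⊢
  rw [integral_eq_tsum_of_embedding (f := fun y => z (x + n * h - y))
    (measurableEmbedding_intCast_mul hh.ne') hUS
    (fun k => ne_top_of_le_ne_top (hfin (k * h)) (measure_mono (by simp))) hn]
end
end
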